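/- (Figalli–Serra, n = 2.) Let n = 2 and let u be a solution of the normalized obstacle problem on Ω ⊆ ℝ². Then the singular stratum Σ_1 is locally contained in a curve of class C²: for every x0 ∈ Σ_1 there exist an open neighborhood U of x0 and a one-dimensional embedded submanifold Γ of ℝ² of class C² such that Σ_1 ∩ U ⊆ Γ. -/

import Mathlib

open MeasureTheory Filter Metric Set
open scoped NNReal ENNReal Topology

noncomputable section

/-- The (pointwise a.e. defined) Laplacian of a `C^{1,1}_loc` function, as the
trace of the derivative of the gradient. -/
def lapGrad {n : ℕ} (w : EuclideanSpace ℝ (Fin n) → ℝ)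
    (x : EuclideanSpace ℝ (Fin n)) : ℝ :=
  ∑ i : Fin n, fderiv ℝ (gradient w) x (EuclideanSpace.single i 1) i

/-- `u` is a solution of the normalized obstacle problem on `Ω`:
`u ∈ C^{1,1}_loc(Ω)`, `u ≥ 0`, and `Δu = χ_{{u>0}}` a.e. on `Ω`. -/
def IsObstacleSol {n : ℕ} (Ω : Set (EuclideanSpace ℝ (Fin n)))
    (u : EuclideanSpace ℝ (Fin n) → ℝ) : Prop :=
  (∀ x ∈ Ω, DifferentiableAt ℝ u x) ∧
  (∀ K : Set (EuclideanSpace ℝ (Fin n)), K ⊆ Ω → IsCompact K →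
    ∃ L : ℝ≥0, LipschitzOnWith L (gradient u) K) ∧
  (∀ x ∈ Ω, 0 ≤ u x) ∧
  (∀ᵐ x ∂(volume.restrict Ω), lapGrad u x = if 0 < u x then 1 else 0)

/-- The free boundary `∂{u > 0} ∩ Ω`. -/
def freeBoundary {n : ℕ} (Ω : Set (EuclideanSpace ℝ (Fin n)))
    (u : EuclideanSpace ℝ (Fin n) → ℝ) : Set (EuclideanSpace ℝ (Fin n)) :=
  frontier {x | x ∈ Ω ∧ 0 < u x} ∩ Ω

/-- The quadratic polynomial `p(x) = (1/2)⟨Ax, x⟩` associated with a matrix `A`. -/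
def quadForm {n : ℕ} (A : Matrix (Fin n) (Fin n) ℝ)
    (x : EuclideanSpace ℝ (Fin n)) : ℝ :=
  (1 / 2) * ∑ i, ∑ j, A i j * x i * x j

/-- `A` encodes an element of `𝒫`: a symmetric nonnegative-definite matrix of
trace `1`. -/
def MemP {n : ℕ} (A : Matrix (Fin n) (Fin n) ℝ) : Prop :=
  A.PosSemidef ∧ A.trace = 1

/-- `x0` is a singular free boundary point: along some sequence `r_k → 0⁺` the
rescalings `u(x0 + r_k x)/r_k²` converge locally uniformly to some `p ∈ 𝒫`. -/
def IsSingularPt {n : ℕ} (Ω : Set (EuclideanSpace ℝ (Fin n)))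
    (u : EuclideanSpace ℝ (Fin n) → ℝ) (x0 : EuclideanSpace ℝ (Fin n)) : Prop :=
  x0 ∈ freeBoundary Ω u ∧
  ∃ (r : ℕ → ℝ) (A : Matrix (Fin n) (Fin n) ℝ),
    (∀ k, 0 < r k) ∧ Tendsto r atTop (𝓝 0) ∧ MemP A ∧
    TendstoLocallyUniformly (fun k x => u (x0 + r k • x) / r k ^ 2)
      (quadForm A) atTop

/-- `p(x) = (1/2)⟨Ax, x⟩ ∈ 𝒫` is the (full) blow-up of `u` at `x0`:
`u(x0 + r x)/r² → p(x)` locally uniformly as `r → 0⁺`. -/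
def IsBlowup {n : ℕ} (u : EuclideanSpace ℝ (Fin n) → ℝ)
    (x0 : EuclideanSpace ℝ (Fin n)) (A : Matrix (Fin n) (Fin n) ℝ) : Prop :=
  MemP A ∧
  TendstoLocallyUniformly (fun (r : ℝ) x => u (x0 + r • x) / r ^ 2)
    (quadForm A) (𝓝[>] 0)

/-- `Γ` is a one-dimensional embedded submanifold of `ℝ²` of class `C²`
(a `C²` curve): locally around each of its points, `Γ` is the regular zero set
of a `C²` function. -/
def IsC2Curve (Γ : Set (EuclideanSpace ℝ (Fin 2))) : Prop :=
  ∀ y ∈ Γ, ∃ V : Set (EuclideanSpace ℝ (Fin 2)), IsOpen V ∧ y ∈ V ∧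
    ∃ F : EuclideanSpace ℝ (Fin 2) → ℝ,
      ContDiffOn ℝ 2 F V ∧
      Γ ∩ V = {z ∈ V | F z = 0} ∧
      ∀ z ∈ Γ ∩ V, fderiv ℝ F z ≠ 0

lemma fs_zeros_finite {R : ℝ} (hR : 0 < R) {f : ℂ → ℂ}
    (hc : ContinuousOn f (closedBall 0 R))
    (han : ∀ z ∈ closedBall (0:ℂ) R, f z = 0 → AnalyticAt ℂ f z)
    (hs : ∀ z ∈ sphere (0:ℂ) R, f z ≠ 0) :
    {z ∈ closedBall (0:ℂ) R | f z = 0}.Finite := by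
  by_contra hinf
  set Z := {z ∈ closedBall (0:ℂ) R | f z = 0} with hZ
  have hZc : IsClosed Z := by
    have := hc.preimage_isClosed_of_isClosed isClosed_closedBall (isClosed_singleton (x := (0:ℂ)))
    exact this
  have hZb : ∀ z ∈ Z, z ∈ ball (0:ℂ) R := by
    intro z hz
    have h1 := hz.1
    rw [mem_closedBall] at h1
    rw [mem_ball]
    rcases lt_or_eq_of_le h1 with h | h
    · exact h
    · exact absurd hz.2 (hs z (by simpa using h))
  obtain ⟨z0, hz0, hacc⟩ := Set.Infinite.exists_accPt_of_subset_isCompact hinf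
    (isCompact_closedBall (0:ℂ) R) (fun z hz => hz.1)
  have hz0Z : z0 ∈ Z := by
    have : z0 ∈ closure Z := mem_closure_iff_clusterPt.2 hacc.clusterPt
    rwa [hZc.closure_eq] at this
  have hfreq : ∃ᶠ z in 𝓝[≠] z0, f z = 0 := by
    rw [accPt_iff_frequently_nhdsNE] at hacc
    exact hacc.mono fun z hz => hz.2
  let W : Set ℂ := {z | ∀ᶠ y in 𝓝 z, f y = 0}
  have hWo : IsOpen W := isOpen_iff_mem_nhds.2 fun z hz => (eventually_eventually_nhds.2 hz)
  have hz0W : z0 ∈ W := ((han z0 hz0 hz0Z.2).frequently_zero_iff_eventually_zero).1 hfreq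
  have hsub : ball (0:ℂ) R ⊆ W := by
    refine IsPreconnected.subset_of_closure_inter_subset (convex_ball _ _).isPreconnected hWo
      ⟨z0, hZb z0 hz0Z, hz0W⟩ ?_
    rintro z ⟨hz1, hz2⟩
    have hzZ : z ∈ Z := by
      rw [← hZc.closure_eq]
      have : z ∈ closure (W ∩ ball 0 R) := by
        have := isOpen_ball.inter_closure (s := ball (0:ℂ) R) (t := W)
        rw [inter_comm W]
        exact this ⟨hz2, hz1⟩
      refine closure_mono ?_ this
      rintro y ⟨hy1, hy2⟩
      exact ⟨ball_subset_closedBall hy2, hy1.self_of_nhds⟩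
    have ha := han z hzZ.1 hzZ.2
    rcases ha.eventually_eq_zero_or_eventually_ne_zero with h | h
    · exact h
    · exfalso
      rw [mem_closure_iff_frequently] at hz1
      rw [eventually_nhdsWithin_iff] at h
      have h2 := h.eventually_nhds
      obtain ⟨y, hyW, hy⟩ := (hz1.and_eventually h2).exists
      have h3 : ∀ᶠ x in 𝓝 y, x = z := by
        filter_upwards [hyW, hy] with x hx1 hx2
        by_contra hne
        exact hx2 hne hx1
      exact (infinite_of_mem_nhds y h3) (Set.finite_singleton z)
  have h0 : (R : ℂ) ∈ Z := by
    rw [← hZc.closure_eq]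
    have : (R : ℂ) ∈ closure (ball (0:ℂ) R) := by
      rw [closure_ball _ hR.ne']; simp [abs_of_pos hR]
    refine closure_mono ?_ this
    exact fun y hy => ⟨ball_subset_closedBall hy, (hsub hy).self_of_nhds⟩
  have := hZb _ h0
  simp [abs_of_pos hR] at this

lemma fs_factor {R : ℝ} (hR : 0 < R) (n : ℕ) : ∀ {f : ℂ → ℂ},
    ContinuousOn f (closedBall 0 R) →
    (∀ z ∈ closedBall (0:ℂ) R, f z = 0 → AnalyticAt ℂ f z) →
    (∀ z ∈ sphere (0:ℂ) R, f z ≠ 0) →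
    {z ∈ closedBall (0:ℂ) R | f z = 0}.ncard = n →
    ∃ s : Multiset ℂ, (∀ a ∈ s, a ∈ ball (0:ℂ) R) ∧ ∃ g : ℂ → ℂ,
      ContinuousOn g (closedBall 0 R) ∧ (∀ z ∈ closedBall (0:ℂ) R, g z ≠ 0) ∧
      ∀ z ∈ closedBall (0:ℂ) R, f z = (s.map (fun a => z - a)).prod * g z := by
  induction n with
  | zero =>
    intro f hc han hs hn
    have hfin := fs_zeros_finite hR hc han hs
    rw [Set.ncard_eq_zero hfin] at hn
    refine ⟨0, by simp, f, hc, ?_, by simp⟩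
    intro z hz h0
    have : z ∈ {z ∈ closedBall (0:ℂ) R | f z = 0} := ⟨hz, h0⟩
    rw [hn] at this
    exact this
  | succ n ih =>
    intro f hc han hs hn
    have hfin := fs_zeros_finite hR hc han hs
    have hne : {z ∈ closedBall (0:ℂ) R | f z = 0}.Nonempty := by
      rw [← Set.ncard_pos hfin]; omega
    obtain ⟨a, ha, hfa⟩ := hne
    have haA := han a ha hfa
    have hab : a ∈ ball (0:ℂ) R := by
      rw [mem_closedBall] at ha
      rw [mem_ball]
      rcases lt_or_eq_of_le ha with h | h
      · exact h
      · exact absurd hfa (hs a (by simpa using h))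
    have hnz : ¬ ∀ᶠ z in 𝓝 a, f z = 0 := by
      intro h
      have h2 : ∀ᶠ z in 𝓝 a, z ∈ {z ∈ closedBall (0:ℂ) R | f z = 0} := by
        filter_upwards [h, isOpen_ball.mem_nhds hab] with z h1 h2
        exact ⟨ball_subset_closedBall h2, h1⟩
      exact (infinite_of_mem_nhds a h2) hfin
    obtain ⟨m, g0, hg0, hg0a, hfg⟩ := (haA.exists_eventuallyEq_pow_smul_nonzero_iff).2 hnz
    have hm : m ≠ 0 := by
      rintro rfl
      have := hfg.self_of_nhds
      simp [hfa] at this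
      exact hg0a this.symm
    let f1 : ℂ → ℂ := fun z => if z = a then g0 a else f z / (z - a) ^ m
    have hf1g : f1 =ᶠ[𝓝 a] g0 := by
      filter_upwards [hfg] with z hz
      by_cases h : z = a
      · simp [f1, h]
      · have : (z - a) ^ m ≠ 0 := pow_ne_zero _ (sub_ne_zero.2 h)
        simp only [f1, h, if_false]
        rw [hz, smul_eq_mul]; field_simp
    have hf1o : ∀ z, z ≠ a → f1 =ᶠ[𝓝 z] fun z => f z / (z - a) ^ m := by
      intro z hz
      filter_upwards [isOpen_ne.mem_nhds hz] with y hy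
      have : y ≠ a := hy
      simp [f1, this]
    have hff1 : ∀ z, f z = (z - a) ^ m * f1 z := by
      intro z
      by_cases h : z = a
      · simp [h, hfa, hm]
      · have : (z - a) ^ m ≠ 0 := pow_ne_zero _ (sub_ne_zero.2 h)
        simp only [f1, h, if_false]; field_simp
    have hf1a : AnalyticAt ℂ f1 a := hg0.congr hf1g.symm
    have hz1 : ∀ z, f1 z = 0 → f z = 0 := fun z hz => by rw [hff1, hz, mul_zero]
    have hf1a0 : f1 a ≠ 0 := by simpa [f1] using hg0a
    have key := @ih f1 ?_ ?_ ?_ ?_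
    · obtain ⟨s, hs1, g, hg1, hg2, hg3⟩ := key
      refine ⟨Multiset.replicate m a + s, ?_, g, hg1, hg2, ?_⟩
      · intro b hb
        rcases Multiset.mem_add.1 hb with h | h
        · rw [Multiset.eq_of_mem_replicate h]; exact hab
        · exact hs1 b h
      · intro z hz
        rw [hff1 z, hg3 z hz]
        simp [mul_assoc]
    · intro z hz
      by_cases h : z = a
      · subst h; exact hf1a.continuousAt.continuousWithinAt
      · have : ContinuousWithinAt (fun z => f z / (z - a) ^ m) (closedBall 0 R) z := by
          refine (hc z hz).div (by fun_prop) (pow_ne_zero _ (sub_ne_zero.2 h))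
        exact this.congr_of_eventuallyEq ((hf1o z h).filter_mono nhdsWithin_le_nhds)
          (hf1o z h).self_of_nhds
    · intro z hz h0
      by_cases h : z = a
      · subst h; exact hf1a
      · refine AnalyticAt.congr ?_ (hf1o z h).symm
        exact (han z hz (hz1 z h0)).div (by fun_prop) (pow_ne_zero _ (sub_ne_zero.2 h))
    · exact fun z hz h0 => hs z hz (hz1 z h0)
    · have : {z ∈ closedBall (0:ℂ) R | f1 z = 0} = {z ∈ closedBall (0:ℂ) R | f z = 0} \ {a} := by
        ext z
        constructor
        · rintro ⟨h1, h2⟩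
          refine ⟨⟨h1, hz1 z h2⟩, ?_⟩
          rintro rfl
          exact hf1a0 h2
        · rintro ⟨⟨h1, h2⟩, h3⟩
          refine ⟨h1, ?_⟩
          have : z ≠ a := h3
          simp [f1, this, h2]
      have ham : a ∈ {z ∈ closedBall (0:ℂ) R | f z = 0} := ⟨ha, hfa⟩
      rw [this, Set.ncard_sdiff_singleton_of_mem ham, hn]; rfl

lemma fs_log {R : ℝ} (hR : 0 < R) {g : ℂ → ℂ} (hg : ContinuousOn g (closedBall 0 R))
    (hg0 : ∀ z ∈ closedBall (0:ℂ) R, g z ≠ 0) :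
    ∃ G : ℂ → ℂ, ContinuousOn G (closedBall 0 R) ∧
      ∀ z ∈ closedBall (0:ℂ) R, g z = Complex.exp (G z) := by
  let ρ : ℂ → ℂ := fun z => (R / max R ‖z‖) • z
  have hρc : Continuous ρ := by
    refine Continuous.smul (Continuous.div continuous_const
      (continuous_const.max continuous_norm) ?_) continuous_id
    intro z; exact (lt_max_of_lt_left hR).ne'
  have hρm : ∀ z, ρ z ∈ closedBall (0:ℂ) R := by
    intro z
    have h : 0 < max R ‖z‖ := lt_max_of_lt_left hR
    simp only [ρ, mem_closedBall, dist_zero_right, norm_smul, Real.norm_eq_abs]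
    rw [abs_of_pos (by positivity), div_mul_eq_mul_div, div_le_iff₀ h]
    gcongr
    exact le_max_right _ _
  have hρe : ∀ z ∈ closedBall (0:ℂ) R, ρ z = z := by
    intro z hz
    rw [mem_closedBall, dist_zero_right] at hz
    simp [ρ, max_eq_left hz, hR.ne']
  have hsc : IsSimplyConnected (univ : Set ℂ) := by
    have : ContractibleSpace (univ : Set ℂ) := (Homeomorph.Set.univ ℂ).contractibleSpace
    exact (inferInstance : SimplyConnectedSpace (univ : Set ℂ))
  obtain ⟨G, hG1, hG2⟩ := Complex.exists_continuousOn_eqOn_exp_comp hsc isOpen_univ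
    (g := g ∘ ρ) ((hg.comp_continuous hρc hρm).continuousOn)
    (by rintro ⟨z, -, hz⟩; exact hg0 _ (hρm z) hz)
  refine ⟨G, hG1.mono (subset_univ _), fun z hz => ?_⟩
  have := hG2 (mem_univ z)
  simp only [Function.comp, hρe z hz] at this
  exact this.symm

lemma fs_prod_log {R : ℝ} (hR : 0 < R) (s : Multiset ℂ) (hs : ∀ a ∈ s, a ∈ ball (0:ℂ) R) :
    ∃ L : ℂ → ℂ, ContinuousOn L (sphere 0 R) ∧ ∀ z ∈ sphere (0:ℂ) R,
      (s.map (fun a => z - a)).prod = z ^ (Multiset.card s) * Complex.exp (L z) := by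
  induction s using Multiset.induction_on with
  | empty => exact ⟨0, continuousOn_const, by simp⟩
  | cons a s ih =>
    obtain ⟨L, hL1, hL2⟩ := ih fun b hb => hs b (Multiset.mem_cons_of_mem hb)
    have ha := hs a (Multiset.mem_cons_self a s)
    rw [mem_ball, dist_zero_right] at ha
    have hz0 : ∀ z ∈ sphere (0:ℂ) R, z ≠ 0 := by
      rintro z hz rfl
      simp at hz; exact hR.ne hz
    have hsl : ∀ z ∈ sphere (0:ℂ) R, 1 - a / z ∈ Complex.slitPlane := by
      intro z hz
      rw [sub_eq_add_neg]
      apply Complex.mem_slitPlane_of_norm_lt_one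
      rw [norm_neg, norm_div, show ‖z‖ = R by simpa using hz, div_lt_one hR]
      exact ha
    refine ⟨fun z => Complex.log (1 - a / z) + L z, ?_, ?_⟩
    · refine ContinuousOn.add (ContinuousOn.clog ?_ hsl) hL1
      exact continuousOn_const.sub (continuousOn_const.div continuousOn_id hz0)
    · intro z hz
      have h1 := hz0 z hz
      have h2 := Complex.slitPlane_ne_zero (hsl z hz)
      rw [Multiset.map_cons, Multiset.prod_cons, Multiset.card_cons, hL2 z hz, Complex.exp_add,
        Complex.exp_log h2]
      field_simp
      ring

lemma fs_exp_const {d : ℝ → ℂ} (hd : Continuous d) (h1 : ∀ t, Complex.exp (d t) = 1) (t : ℝ) :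
    d t = d 0 := by
  have := Complex.isCoveringMap_exp.eq_of_comp_eq (A := ℝ) (g₁ := d) (g₂ := fun _ => d 0) hd
    continuous_const (by funext s; simp [h1]) 0 rfl
  exact congrFun this t

lemma fs_card {R : ℝ} (hR : 0 < R) (s : Multiset ℂ) (hs : ∀ a ∈ s, a ∈ ball (0:ℂ) R)
    {g l : ℂ → ℂ} (hg : ContinuousOn g (closedBall 0 R))
    (hg0 : ∀ z ∈ closedBall (0:ℂ) R, g z ≠ 0) (hl : ContinuousOn l (sphere 0 R)) (k : ℕ)
    (h : ∀ z ∈ sphere (0:ℂ) R, (s.map (fun a => z - a)).prod * g z = z ^ k * Complex.exp (l z)) :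
    Multiset.card s = k := by
  obtain ⟨G, hG1, hG2⟩ := fs_log hR hg hg0
  obtain ⟨L, hL1, hL2⟩ := fs_prod_log hR s hs
  set m := Multiset.card s
  let z : ℝ → ℂ := fun t => R * Complex.exp (t * Complex.I)
  have hzs : ∀ t, z t ∈ sphere (0:ℂ) R := by
    intro t; simp [z, Complex.norm_exp_ofReal_mul_I, abs_of_pos hR]
  have hzc : Continuous z := by fun_prop
  have hzb : ∀ t, z t ∈ closedBall (0:ℂ) R := fun t => sphere_subset_closedBall (hzs t)
  let e : ℝ → ℂ := fun t => L (z t) + G (z t) - l (z t) + ((m:ℂ) - k) * Real.log R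
  have hec : Continuous e := by
    have h1 := hL1.comp_continuous hzc hzs
    have h2 := hG1.comp_continuous hzc hzb
    have h3 := hl.comp_continuous hzc hzs
    exact ((h1.add h2).sub h3).add continuous_const
  let d : ℝ → ℂ := fun t => ((m:ℂ) - k) * (t * Complex.I) + e t
  have hd : Continuous d := by fun_prop
  have hRlog : Complex.exp (Real.log R) = R := by
    rw [← Complex.ofReal_exp, Real.exp_log hR]
  have hzexp : ∀ t : ℝ, z t = Complex.exp (t * Complex.I + Real.log R) := by
    intro t; rw [Complex.exp_add, hRlog, mul_comm]
  have hd1 : ∀ t, Complex.exp (d t) = 1 := by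
    intro t
    have h1 := h (z t) (hzs t)
    rw [hL2 _ (hzs t), hG2 _ (hzb t), hzexp t] at h1
    rw [← hzexp t, hzexp t] at h1
    rw [← Complex.exp_nat_mul, ← Complex.exp_nat_mul, ← Complex.exp_add, ← Complex.exp_add,
      ← Complex.exp_add, ← hzexp t] at h1
    have : d t = ((m:ℂ) * (t * Complex.I + Real.log R) + L (z t) + G (z t)) -
      (k * (t * Complex.I + Real.log R) + l (z t)) := by
      simp only [d, e]; ring
    rw [this, Complex.exp_sub, h1, div_self (Complex.exp_ne_zero _)]
  have h2 := fs_exp_const hd hd1 (2 * Real.pi)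
  have h3 : z (2 * Real.pi) = z 0 := by
    simp [z, Complex.exp_two_pi_mul_I]
  simp only [d, e, h3] at h2
  have h4 : ((m:ℂ) - k) * (2 * Real.pi * Complex.I) = 0 := by
    push_cast at h2
    linear_combination h2
  have h5 : ((m:ℂ) - k) = 0 := by
    rcases mul_eq_zero.1 h4 with h | h
    · exact h
    · exact absurd h Complex.two_pi_I_ne_zero
  have h6 : (m:ℂ) = k := sub_eq_zero.1 h5
  exact_mod_cast h6

/-- General counting lemma. -/
lemma fs_count {R : ℝ} (hR : 0 < R) {f l : ℂ → ℂ}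
    (hc : ContinuousOn f (closedBall 0 R))
    (han : ∀ z ∈ closedBall (0:ℂ) R, f z = 0 → AnalyticAt ℂ f z)
    (hl : ContinuousOn l (sphere 0 R)) (k : ℕ)
    (hs : ∀ z ∈ sphere (0:ℂ) R, f z = z ^ k * Complex.exp (l z)) :
    ∃ s : Multiset ℂ, Multiset.card s = k ∧ (∀ a ∈ s, a ∈ ball (0:ℂ) R) ∧ ∃ g : ℂ → ℂ,
      ContinuousOn g (closedBall 0 R) ∧ (∀ z ∈ closedBall (0:ℂ) R, g z ≠ 0) ∧
      ∀ z ∈ closedBall (0:ℂ) R, f z = (s.map (fun a => z - a)).prod * g z := by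
  have hs0 : ∀ z ∈ sphere (0:ℂ) R, f z ≠ 0 := by
    intro z hz
    rw [hs z hz]
    refine mul_ne_zero (pow_ne_zero _ ?_) (Complex.exp_ne_zero _)
    rintro rfl
    simp at hz; exact hR.ne hz
  obtain ⟨s, h1, g, h2, h3, h4⟩ := fs_factor hR _ hc han hs0 rfl
  refine ⟨s, fs_card hR s h1 h2 h3 hl k ?_, h1, g, h2, h3, h4⟩
  intro z hz
  rw [← h4 z (sphere_subset_closedBall hz), hs z hz]

lemma fs_count0 {R : ℝ} (hR : 0 < R) {f : ℂ → ℂ} {c : ℂ}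
    (hc : ContinuousOn f (closedBall 0 R))
    (han : ∀ z ∈ closedBall (0:ℂ) R, f z = 0 → AnalyticAt ℂ f z)
    (hs : ∀ z ∈ sphere (0:ℂ) R, ‖f z - c‖ < ‖c‖) :
    ∀ z ∈ closedBall (0:ℂ) R, f z ≠ 0 := by
  have hc0 : c ≠ 0 := by
    rintro rfl
    have := hs R (by simp [abs_of_pos hR])
    rw [norm_zero] at this
    exact absurd this (not_lt.2 (norm_nonneg _))
  have hsl : ∀ z ∈ sphere (0:ℂ) R, f z / c ∈ Complex.slitPlane := by
    intro z hz
    have : f z / c = 1 + (f z - c) / c := by field_simp; ring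
    rw [this]
    apply Complex.mem_slitPlane_of_norm_lt_one
    rw [norm_div, div_lt_one (norm_pos_iff.2 hc0)]
    exact hs z hz
  obtain ⟨s, h0, h1, g, h2, h3, h4⟩ := fs_count hR (f := f)
    (l := fun z => Complex.log (f z / c) + Complex.log c) hc han
    (((((hc.mono sphere_subset_closedBall).div_const c).clog hsl)).add continuousOn_const) 0 (by
      intro z hz
      rw [Complex.exp_add, Complex.exp_log (Complex.slitPlane_ne_zero (hsl z hz)),
        Complex.exp_log hc0]
      field_simp)
  rw [Multiset.card_eq_zero] at h0
  intro z hz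
  rw [h4 z hz, h0]
  simpa using h3 z hz

lemma fs_count1 {R : ℝ} (hR : 0 < R) {f : ℂ → ℂ} {c : ℂ}
    (hc : ContinuousOn f (closedBall 0 R))
    (han : ∀ z ∈ closedBall (0:ℂ) R, f z = 0 → AnalyticAt ℂ f z)
    (hs : ∀ z ∈ sphere (0:ℂ) R, ‖f z - c * z‖ < ‖c‖ * R) :
    ∃ a ∈ ball (0:ℂ) R, f a = 0 ∧ (∀ z ∈ closedBall (0:ℂ) R, f z = 0 → z = a) ∧
      ∃ b ≠ 0, HasDerivAt f b a := by
  have hc0 : c ≠ 0 := by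
    rintro rfl
    have := hs R (by simp [abs_of_pos hR])
    simp only [norm_zero, zero_mul] at this
    exact absurd this (not_lt.2 (norm_nonneg _))
  have hz0 : ∀ z ∈ sphere (0:ℂ) R, z ≠ 0 := by
    rintro z hz rfl
    simp at hz; exact hR.ne hz
  have hsl : ∀ z ∈ sphere (0:ℂ) R, f z / (c * z) ∈ Complex.slitPlane := by
    intro z hz
    have h1 := hz0 z hz
    have : f z / (c * z) = 1 + (f z - c * z) / (c * z) := by field_simp; ring
    rw [this]
    apply Complex.mem_slitPlane_of_norm_lt_one
    rw [norm_div, div_lt_one (norm_pos_iff.2 (mul_ne_zero hc0 h1)), norm_mul,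
      show ‖z‖ = R by simpa using hz]
    exact hs z hz
  obtain ⟨s, h0, h1, g, h2, h3, h4⟩ := fs_count hR (f := f)
    (l := fun z => Complex.log (f z / (c * z)) + Complex.log c) hc han
    (((((hc.mono sphere_subset_closedBall).div (continuousOn_const.mul continuousOn_id)
      (fun z hz => mul_ne_zero hc0 (hz0 z hz))).clog hsl)).add continuousOn_const) 1 (by
      intro z hz
      have h1 := hz0 z hz
      rw [Complex.exp_add, Complex.exp_log (Complex.slitPlane_ne_zero (hsl z hz)),
        Complex.exp_log hc0]
      field_simp)
  rw [Multiset.card_eq_one] at h0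
  obtain ⟨a, rfl⟩ := h0
  have ha : a ∈ ball (0:ℂ) R := h1 a (by simp)
  have h5 : ∀ z ∈ closedBall (0:ℂ) R, f z = (z - a) * g z := by
    intro z hz; simpa using h4 z hz
  refine ⟨a, ha, by simp [h5 a (ball_subset_closedBall ha)], ?_, g a,
    h3 a (ball_subset_closedBall ha), ?_⟩
  · intro z hz h
    rw [h5 z hz] at h
    rcases mul_eq_zero.1 h with h | h
    · exact sub_eq_zero.1 h
    · exact absurd h (h3 z hz)
  · rw [hasDerivAt_iff_tendsto_slope]
    have hga : Tendsto g (𝓝[≠] a) (𝓝 (g a)) :=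
      ((h2.continuousAt (closedBall_mem_nhds_of_mem ha)).tendsto).mono_left nhdsWithin_le_nhds
    refine hga.congr' ?_
    filter_upwards [self_mem_nhdsWithin,
      nhdsWithin_le_nhds (isOpen_ball.mem_nhds ha)] with z hz1 hz2
    have : z - a ≠ 0 := sub_ne_zero.2 hz1
    rw [slope_def_field, h5 z (ball_subset_closedBall hz2), h5 a (ball_subset_closedBall ha)]
    field_simp
    ring

lemma fs_line_removable {U : Set ℂ} (hU : IsOpen U) {P : ℂ → ℂ} (hc : ContinuousOn P U)
    (hd : ∀ z ∈ U, z.im ≠ 0 → DifferentiableAt ℂ P z) : DifferentiableOn ℂ P U := by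
  refine (Complex.isConservativeOn_and_continuousOn_iff_isDifferentiableOn hU).1 ⟨?_, hc⟩
  have key : ∀ z w : ℂ, ((uIcc (z.re) (w.re)) ×ℂ (uIcc (z.im) (w.im))) ⊆ U →
      (0 : ℝ) ∉ Ioo (min z.im w.im) (max z.im w.im) →
      (∫ x : ℝ in z.re..w.re, P (x + z.im * Complex.I)) -
      (∫ x : ℝ in z.re..w.re, P (x + w.im * Complex.I)) +
      Complex.I • (∫ y : ℝ in z.im..w.im, P (w.re + y * Complex.I)) -
      Complex.I • (∫ y : ℝ in z.im..w.im, P (z.re + y * Complex.I)) = 0 := by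
    intro z w hsub h0
    refine Complex.integral_boundary_rect_eq_zero_of_continuousOn_of_differentiableOn P z w
      (hc.mono hsub) ?_
    intro x hx
    refine (hd x (hsub ?_) ?_).differentiableWithinAt
    · exact ⟨Ioo_subset_Icc_self hx.1, Ioo_subset_Icc_self hx.2⟩
    · intro h
      apply h0
      have := hx.2
      rwa [mem_preimage, h] at this
  intro z w hsub
  have hsub' : ((uIcc (z.re) (w.re)) ×ℂ (uIcc (z.im) (w.im))) ⊆ U := hsub
  rw [← add_eq_zero_iff_eq_neg, Complex.wedgeIntegral_add_wedgeIntegral_eq]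
  by_cases h0 : (0:ℝ) ∈ (uIcc (z.im) (w.im))
  · have hs1 : (uIcc (z.im) (0)) ⊆ (uIcc (z.im) (w.im)) := uIcc_subset_uIcc_left h0
    have hs2 : (uIcc (0) (w.im)) ⊆ (uIcc (z.im) (w.im)) := uIcc_subset_uIcc_right h0
    have k1 := key z ⟨w.re, 0⟩ (fun x hx => hsub' ⟨hx.1, hs1 hx.2⟩) (by
      rintro ⟨h1, h2⟩
      rcases le_total z.im 0 with h | h
      · simp [h] at h2
      · simp [h] at h1)
    have k2 := key ⟨z.re, 0⟩ w (fun x hx => hsub' ⟨hx.1, hs2 hx.2⟩) (by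
      rintro ⟨h1, h2⟩
      rcases le_total w.im 0 with h | h
      · simp [h] at h2
      · simp [h] at h1)
    have hv : ∀ a ∈ (uIcc (z.re) (w.re)), ∀ b c : ℝ, (uIcc (b) (c)) ⊆ (uIcc (z.im) (w.im)) →
        IntervalIntegrable (fun y : ℝ => P (a + y * Complex.I)) volume b c := by
      intro a ha b c hbc
      apply ContinuousOn.intervalIntegrable
      refine hc.comp (by fun_prop) ?_
      intro y hy
      apply hsub'
      refine ⟨?_, ?_⟩
      · simpa using ha
      · simpa using hbc hy
    have e1 := intervalIntegral.integral_add_adjacent_intervals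
      (hv w.re right_mem_uIcc _ _ hs1) (hv w.re right_mem_uIcc _ _ hs2)
    have e2 := intervalIntegral.integral_add_adjacent_intervals
      (hv z.re left_mem_uIcc _ _ hs1) (hv z.re left_mem_uIcc _ _ hs2)
    rw [← e1, ← e2]
    simp only [smul_eq_mul] at *
    linear_combination k1 + k2
  · exact key z w hsub' fun h => h0 (Ioo_subset_Icc_self h)

lemma fs_half_primitive {D : Set ℂ} (hD : Convex ℝ D) (hDo : IsOpen D) {f : ℂ → ℂ} {M : ℝ≥0}
    (hf : DifferentiableOn ℂ f D) (hM : ∀ z ∈ D, ‖f z‖ ≤ M) :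
    ∃ (E : ℂ → ℂ), Continuous E ∧ ∀ z ∈ D, HasDerivAt E (f z) z := by
  obtain ⟨G, hG⟩ := hD.exists_forall_hasDerivWithinAt hf
  have hL : LipschitzOnWith M G D :=
    hD.lipschitzOnWith_of_nnnorm_hasDerivWithin_le hG (fun z hz => by
      have := hM z hz
      exact_mod_cast this)
  obtain ⟨E, hE1, hE2⟩ := hL.extend_finite_dimension
  refine ⟨E, hE1.continuous, fun z hz => ?_⟩
  have h := (hG z hz).hasDerivAt (hDo.mem_nhds hz)
  refine h.congr_of_eventuallyEq ?_
  filter_upwards [hDo.mem_nhds hz] with y hy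
  exact (hE2 hy).symm

lemma fs_reflect {s : ℝ} (hs : 0 < s) {F0 : ℂ → ℂ} {M : ℝ≥0}
    (hd : ∀ z ∈ ball (0:ℂ) s, z.im ≠ 0 → DifferentiableAt ℂ F0 z)
    (hM : ∀ z ∈ ball (0:ℂ) s, z.im ≠ 0 → ‖F0 z‖ ≤ M)
    (hj : ∀ t : ℝ, |t| < s → Tendsto (fun ε : ℝ => F0 (t + ε * Complex.I) - F0 (t - ε * Complex.I))
      (𝓝[>] 0) (𝓝 0)) :
    ∃ F : ℂ → ℂ, DifferentiableOn ℂ F (ball 0 s) ∧ ∀ z ∈ ball (0:ℂ) s, z.im ≠ 0 → F z = F0 z := by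
  have hup : IsOpen {z : ℂ | 0 < z.im} := isOpen_lt continuous_const Complex.continuous_im
  have hlo : IsOpen {z : ℂ | z.im < 0} := isOpen_lt Complex.continuous_im continuous_const
  have hDp : Convex ℝ (ball (0:ℂ) s ∩ {z | 0 < z.im}) :=
    (convex_ball _ _).inter (convex_halfSpace_im_gt 0)
  have hDm : Convex ℝ (ball (0:ℂ) s ∩ {z | z.im < 0}) :=
    (convex_ball _ _).inter (convex_halfSpace_im_lt 0)
  obtain ⟨Ep, hEpc, hEp⟩ := fs_half_primitive hDp (isOpen_ball.inter hup) (f := F0) (M := M)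
    (fun z hz => (hd z hz.1 (ne_of_gt hz.2)).differentiableWithinAt)
    (fun z hz => hM z hz.1 (ne_of_gt hz.2))
  obtain ⟨Em, hEmc, hEm⟩ := fs_half_primitive hDm (isOpen_ball.inter hlo) (f := F0) (M := M)
    (fun z hz => (hd z hz.1 (ne_of_lt hz.2)).differentiableWithinAt)
    (fun z hz => hM z hz.1 (ne_of_lt hz.2))
  -- the jump is constant
  have hJ : ∀ t : ℝ, |t| < s → Ep t - Em t = Ep 0 - Em 0 := by
    intro t ht
    have hball : ∀ᶠ ε : ℝ in 𝓝[>] 0, 0 < ε ∧ ∀ x ∈ (uIcc (0) (t)), ∀ σ : ℝ, |σ| = 1 →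
        (x : ℂ) + (σ * ε : ℝ) * Complex.I ∈ ball (0:ℂ) s := by
      have : ∀ᶠ ε : ℝ in 𝓝[>] 0, ε < s - |t| :=
        nhdsWithin_le_nhds (gt_mem_nhds (sub_pos.2 ht))
      filter_upwards [this, self_mem_nhdsWithin] with ε h1 h2
      have h2' : 0 < ε := h2
      refine ⟨h2, fun x hx σ hσ => ?_⟩
      rw [mem_ball, dist_zero_right]
      refine lt_of_le_of_lt (norm_add_le _ _) ?_
      have hx' : |x| ≤ |t| := by
        rcases le_total 0 t with h | h
        · rw [uIcc_of_le h] at hx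
          rw [abs_of_nonneg hx.1, abs_of_nonneg h]; exact hx.2
        · rw [uIcc_of_ge h] at hx
          rw [abs_of_nonpos hx.2, abs_of_nonpos h]; linarith [hx.1]
      simp [abs_mul, hσ, abs_of_pos h2']
      linarith
    have hlim1 : Tendsto (fun ε : ℝ => ∫ x in (0:ℝ)..t,
        (F0 (x + ε * Complex.I) - F0 (x - ε * Complex.I))) (𝓝[>] 0) (𝓝 (∫ x in (0:ℝ)..t, (0:ℂ))) := by
      refine intervalIntegral.tendsto_integral_filter_of_dominated_convergence (fun _ => (M:ℝ) + M)
        ?_ ?_ intervalIntegrable_const ?_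
      · filter_upwards [hball] with ε ⟨hε, hb⟩
        have hc : ContinuousOn (fun x : ℝ => F0 (x + ε * Complex.I) - F0 (x - ε * Complex.I))
            (uIcc (0) (t)) := by
          refine ContinuousOn.sub ?_ ?_
          · intro x hx
            have h1 := hb x hx 1 (by simp)
            have h2 := (hd (x + ε * Complex.I) (by simpa using h1)
              (by simp [hε.ne'])).continuousAt
            exact (ContinuousAt.comp (f := fun x : ℝ => (x:ℂ) + ε * Complex.I) h2
              (by fun_prop)).continuousWithinAt
          · intro x hx
            have h1 := hb x hx (-1) (by simp)
            have h2 := (hd (x - ε * Complex.I) (by simpa [sub_eq_add_neg] using h1)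
              (by simp [hε.ne'])).continuousAt
            exact (ContinuousAt.comp (f := fun x : ℝ => (x:ℂ) - ε * Complex.I) h2
              (by fun_prop)).continuousWithinAt
        exact (hc.mono uIoc_subset_uIcc).aestronglyMeasurable measurableSet_uIoc
      · filter_upwards [hball] with ε ⟨hε, hb⟩
        refine Eventually.of_forall fun x hx => ?_
        have hx' := uIoc_subset_uIcc hx
        have h1 := hb x hx' 1 (by simp)
        have h2 := hb x hx' (-1) (by simp)
        refine (norm_sub_le _ _).trans (add_le_add ?_ ?_)
        · exact hM _ (by simpa using h1) (by simp [hε.ne'])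
        · exact hM _ (by simpa [sub_eq_add_neg] using h2) (by simp [hε.ne'])
      · refine Eventually.of_forall fun x hx => hj x ?_
        have hx := uIoc_subset_uIcc hx
        rcases le_total 0 t with h | h
        · rw [uIcc_of_le h] at hx
          rw [abs_of_nonneg hx.1]; rw [abs_of_nonneg h] at ht; linarith [hx.2]
        · rw [uIcc_of_ge h] at hx
          rw [abs_of_nonpos hx.2]; rw [abs_of_nonpos h] at ht; linarith [hx.1]
    have hlim2 : Tendsto (fun ε : ℝ => (Ep (t + ε * Complex.I) - Em (t - ε * Complex.I)) -
        (Ep (0 + ε * Complex.I) - Em (0 - ε * Complex.I))) (𝓝[>] 0)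
        (𝓝 ((Ep t - Em t) - (Ep 0 - Em 0))) := by
      have : Continuous (fun ε : ℝ => (Ep (t + ε * Complex.I) - Em (t - ε * Complex.I)) -
        (Ep (0 + ε * Complex.I) - Em (0 - ε * Complex.I))) := by fun_prop
      have h := this.tendsto 0
      simp only [Complex.ofReal_zero, zero_mul, add_zero, sub_zero] at h
      exact h.mono_left nhdsWithin_le_nhds
    have heq : (fun ε : ℝ => ∫ x in (0:ℝ)..t,
        (F0 (x + ε * Complex.I) - F0 (x - ε * Complex.I))) =ᶠ[𝓝[>] 0]
        (fun ε : ℝ => (Ep (t + ε * Complex.I) - Em (t - ε * Complex.I)) -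
        (Ep (0 + ε * Complex.I) - Em (0 - ε * Complex.I))) := by
      filter_upwards [hball] with ε ⟨hε, hb⟩
      have hder : ∀ x ∈ (uIcc (0) (t)), HasDerivAt (fun x : ℝ => Ep (x + ε * Complex.I) -
          Em (x - ε * Complex.I)) (F0 (x + ε * Complex.I) - F0 (x - ε * Complex.I)) x := by
        intro x hx
        have h1 := hEp (x + ε * Complex.I) ⟨by simpa using hb x hx 1 (by simp), by simpa using hε⟩
        have h2 := hEm (x - ε * Complex.I)
          ⟨by simpa [sub_eq_add_neg] using hb x hx (-1) (by simp), by simpa using hε⟩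
        have k1 : HasDerivAt (fun x : ℝ => (x:ℂ) + ε * Complex.I) 1 x :=
          (Complex.ofRealCLM.hasDerivAt (x := x)).add_const _
        have k2 : HasDerivAt (fun x : ℝ => (x:ℂ) - ε * Complex.I) 1 x :=
          (Complex.ofRealCLM.hasDerivAt (x := x)).sub_const _
        have h3 := HasDerivAt.comp x h1 k1
        have h4 := HasDerivAt.comp x h2 k2
        have h5 := h3.sub h4
        rw [mul_one, mul_one] at h5
        exact h5
      have hc : ContinuousOn (fun x : ℝ => F0 (x + ε * Complex.I) - F0 (x - ε * Complex.I))
            (uIcc (0) (t)) := by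
        refine ContinuousOn.sub ?_ ?_
        · intro x hx
          have h1 := hb x hx 1 (by simp)
          have h2 := (hd (x + ε * Complex.I) (by simpa using h1)
            (by simp [hε.ne'])).continuousAt
          exact (ContinuousAt.comp (f := fun x : ℝ => (x:ℂ) + ε * Complex.I) h2
            (by fun_prop)).continuousWithinAt
        · intro x hx
          have h1 := hb x hx (-1) (by simp)
          have h2 := (hd (x - ε * Complex.I) (by simpa [sub_eq_add_neg] using h1)
            (by simp [hε.ne'])).continuousAt
          exact (ContinuousAt.comp (f := fun x : ℝ => (x:ℂ) - ε * Complex.I) h2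
            (by fun_prop)).continuousWithinAt
      have := intervalIntegral.integral_eq_sub_of_hasDerivAt hder hc.intervalIntegrable
      simpa using this
    have := tendsto_nhds_unique (hlim1.congr' heq) hlim2
    simp at this
    exact sub_eq_zero.1 this.symm
  let P : ℂ → ℂ := fun z => if 0 ≤ z.im then Ep z else Em z + (Ep 0 - Em 0)
  have hPp : ∀ z, 0 < z.im → P =ᶠ[𝓝 z] Ep := by
    intro z hz
    filter_upwards [hup.mem_nhds hz] with y hy
    have : 0 ≤ y.im := le_of_lt hy
    simp [P, this]
  have hPm : ∀ z, z.im < 0 → P =ᶠ[𝓝 z] fun z => Em z + (Ep 0 - Em 0) := by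
    intro z hz
    filter_upwards [hlo.mem_nhds hz] with y hy
    have : ¬ 0 ≤ y.im := not_le.2 hy
    simp [P, this]
  have hPd : ∀ z ∈ ball (0:ℂ) s, z.im ≠ 0 → HasDerivAt P (F0 z) z := by
    intro z hz h0
    rcases lt_or_gt_of_ne h0 with h | h
    · exact ((hEm z ⟨hz, h⟩).add_const _).congr_of_eventuallyEq (hPm z h)
    · exact (hEp z ⟨hz, h⟩).congr_of_eventuallyEq (hPp z h)
  have hPm' : ∀ z ∈ ball (0:ℂ) s, z.im ≤ 0 → P z = Em z + (Ep 0 - Em 0) := by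
    intro z hz h0
    rcases lt_or_eq_of_le h0 with h | h
    · exact (hPm z h).self_of_nhds
    · have hz' : z = (z.re : ℂ) := by apply Complex.ext <;> simp [h]
      have h2 : |z.re| < s := by
        rw [mem_ball, dist_zero_right] at hz
        exact lt_of_le_of_lt (Complex.abs_re_le_norm z) hz
      have := hJ z.re h2
      rw [← hz'] at this
      simp only [P, h, le_refl, if_true]
      linear_combination this
  have hPc : ContinuousOn P (ball 0 s) := by
    have h1 : ∀ z, ContinuousWithinAt P (ball 0 s ∩ {z | 0 ≤ z.im}) z ∨ ¬ 0 ≤ z.im := by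
      intro z
      by_cases h : 0 ≤ z.im
      · left
        refine hEpc.continuousWithinAt.congr ?_ ?_
        · intro y hy
          have : 0 ≤ y.im := hy.2
          simp [P, this]
        · simp [P, h]
      · exact Or.inr h
    intro z hz
    rcases lt_trichotomy z.im 0 with h | h | h
    · exact (hPd z hz h.ne).continuousAt.continuousWithinAt
    · have a1 := (h1 z).resolve_right (by simp [h])
      have a2 : ContinuousWithinAt P (ball 0 s ∩ {z | z.im ≤ 0}) z := by
        refine ((hEmc.add continuous_const).continuousWithinAt).congr ?_ ?_ (f := fun z => Em z + (Ep 0 - Em 0))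
        · intro y hy; exact hPm' y hy.1 hy.2
        · exact hPm' z hz h.le
      refine (a1.union a2).mono ?_
      intro y hy
      rcases le_total 0 y.im with h | h
      · exact Or.inl ⟨hy, h⟩
      · exact Or.inr ⟨hy, h⟩
    · exact (hPd z hz h.ne').continuousAt.continuousWithinAt
  have hP := fs_line_removable isOpen_ball hPc fun z hz h => (hPd z hz h).differentiableAt
  exact ⟨deriv P, hP.deriv isOpen_ball, fun z hz h => (hPd z hz h).deriv⟩

lemma fs_real_of_K {S : ℂ → ℂ} {K : Set ℂ} (hK : ∀ z ∈ K, S z = (starRingEnd ℂ) z)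
    {z : ℂ} (hz : z ∈ K) : (z + S z) / 2 = (z.re : ℂ) := by
  rw [hK z hz, Complex.add_conj]; push_cast; ring

lemma fs_phi {r : ℝ} (hr : 0 < r) {S : ℂ → ℂ} {K : Set ℂ}
    (hSc : ContinuousOn S (closedBall 0 r)) (hK : ∀ z ∈ K, S z = (starRingEnd ℂ) z)
    (hol : ∀ z ∈ closedBall (0:ℂ) r, z ∉ K → AnalyticAt ℂ S z)
    (hb : ∀ z ∈ closedBall (0:ℂ) r, ‖S z - z‖ ≤ ‖z‖ / 4) :
    ∃ φ : ℂ → ℂ, ∀ w : ℂ, ‖w‖ < r / 2 → w.im ≠ 0 →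
      ‖φ w‖ < r ∧ (φ w + S (φ w)) / 2 = w ∧
      (∀ z ∈ closedBall (0:ℂ) r, (z + S z) / 2 = w → z = φ w) ∧ DifferentiableAt ℂ φ w := by
  have hoff : ∀ w : ℂ, w.im ≠ 0 → ∀ z, (z + S z) / 2 = w → z ∉ K := by
    intro w hw z hz hzK
    rw [fs_real_of_K hK hzK] at hz
    apply hw; rw [← hz]; simp
  have hHan : ∀ z ∈ closedBall (0:ℂ) r, z ∉ K → AnalyticAt ℂ (fun z => (z + S z) / 2) z := by
    intro z hz hzK
    have := hol z hz hzK
    exact (analyticAt_id.add this).div_const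
  have h1 : ∀ w : ℂ, ‖w‖ < r / 2 ∧ w.im ≠ 0 → ∃ a : ℂ, ‖a‖ < r ∧ (a + S a) / 2 = w ∧
      (∀ z ∈ closedBall (0:ℂ) r, (z + S z) / 2 = w → z = a) ∧
      ∃ b ≠ 0, HasDerivAt (fun z => (z + S z) / 2) b a := by
    rintro w ⟨hw, hw0⟩
    obtain ⟨a, ha, ha0, hau, b, hb0, hbd⟩ := fs_count1 hr (f := fun z => (z + S z) / 2 - w) (c := 1)
      (((continuousOn_id.add hSc).div_const 2).sub continuousOn_const) (by
        intro z hz h0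
        exact (hHan z hz (hoff w hw0 z (sub_eq_zero.1 h0))).sub analyticAt_const) (by
        intro z hz
        have hzr : ‖z‖ = r := by simpa using hz
        have h2 := hb z (sphere_subset_closedBall hz)
        have : (z + S z) / 2 - w - 1 * z = (S z - z) / 2 - w := by ring
        rw [this, norm_one, one_mul]
        refine lt_of_le_of_lt (norm_sub_le _ _) ?_
        rw [norm_div, Complex.norm_ofNat]
        rw [hzr] at h2
        linarith)
    refine ⟨a, by simpa using ha, sub_eq_zero.1 ha0, fun z hz h => hau z hz (sub_eq_zero.2 h), b,
      hb0, ?_⟩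
    have := hbd.add_const w
    simpa using this
  choose! φ hφ using h1
  refine ⟨φ, fun w hw hw0 => ?_⟩
  obtain ⟨h2, h3, h4, b, hb0, hbd⟩ := hφ w ⟨hw, hw0⟩
  refine ⟨h2, h3, h4, ?_⟩
  have hA := hHan (φ w) (by simpa using h2.le) (hoff w hw0 _ h3)
  have hst : HasStrictDerivAt (fun z => (z + S z) / 2) b (φ w) := by
    have := hA.hasStrictDerivAt
    rwa [hbd.deriv] at this
  have hinv : ∀ᶠ x in 𝓝 (φ w), φ ((x + S x) / 2) = x := by
    have hc := hA.continuousAt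
    have hopen : IsOpen {w : ℂ | ‖w‖ < r / 2 ∧ w.im ≠ 0} :=
      (isOpen_lt continuous_norm continuous_const).inter
        (isOpen_ne_fun Complex.continuous_im continuous_const)
    have e1 : ∀ᶠ x in 𝓝 (φ w), (x + S x) / 2 ∈ {w : ℂ | ‖w‖ < r / 2 ∧ w.im ≠ 0} := by
      apply hc.eventually
      apply hopen.mem_nhds
      change (φ w + S (φ w)) / 2 ∈ _
      rw [h3]; exact ⟨hw, hw0⟩
    have e2 : ∀ᶠ x in 𝓝 (φ w), x ∈ closedBall (0:ℂ) r :=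
      closedBall_mem_nhds_of_mem (by simpa using h2)
    filter_upwards [e1, e2] with x hx1 hx2
    exact ((hφ _ hx1).2.2.1 x hx2 rfl).symm
  have := hst.to_local_left_inverse hb0 hinv
  rw [h3] at this
  exact this.hasDerivAt.differentiableAt

lemma fs_open_map {r t : ℝ} {S : ℂ → ℂ} {K : Set ℂ} (ht : |t| < r / 2)
    (hol : ∀ z ∈ closedBall (0:ℂ) r, z ∉ K → AnalyticAt ℂ S z)
    (hb : ∀ z ∈ closedBall (0:ℂ) r, ‖S z - z‖ ≤ ‖z‖ / 4)
    {φ : ℂ → ℂ} (hφ : ∀ w : ℂ, ‖w‖ < r / 2 → w.im ≠ 0 →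
      ‖φ w‖ < r ∧ (φ w + S (φ w)) / 2 = w ∧
      (∀ z ∈ closedBall (0:ℂ) r, (z + S z) / 2 = w → z = φ w) ∧ DifferentiableAt ℂ φ w)
    {ι : Type*} {l : Filter ι} [l.NeBot] {w w' : ι → ℂ} (hw : Tendsto w l (𝓝 t))
    (hw' : Tendsto w' l (𝓝 t)) (hi : ∀ᶠ j in l, (w j).im ≠ 0) (hi' : ∀ᶠ j in l, (w' j).im ≠ 0)
    {z : ℂ} (hz : z ∈ closedBall (0:ℂ) r) (hzK : z ∉ K) (hHz : (z + S z) / 2 = t)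
    (hlim : Tendsto (fun j => φ (w j)) l (𝓝 z)) : Tendsto (fun j => φ (w' j)) l (𝓝 z) := by
  have hHan : AnalyticAt ℂ (fun z => (z + S z) / 2) z :=
    (analyticAt_id.add (hol z hz hzK)).div_const
  have hsm : ∀ {v : ι → ℂ}, Tendsto v l (𝓝 (t:ℂ)) → ∀ᶠ j in l, ‖v j‖ < r / 2 := by
    intro v hv
    apply hv.norm.eventually_lt_const
    simpa using ht
  have hzr : z ∈ ball (0:ℂ) r := by
    have h1 := hb z hz
    have h2 : z = t - (S z - z) / 2 := by rw [← hHz]; ring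
    have h3 : ‖z‖ ≤ |t| + ‖z‖ / 8 := by
      calc ‖z‖ = ‖(t:ℂ) - (S z - z) / 2‖ := by rw [← h2]
        _ ≤ ‖(t:ℂ)‖ + ‖(S z - z) / 2‖ := norm_sub_le _ _
        _ ≤ |t| + ‖z‖ / 8 := by
          rw [norm_div, Complex.norm_ofNat, Complex.norm_real, Real.norm_eq_abs]; linarith
    have := norm_nonneg z
    simp
    linarith [abs_nonneg t]
  rcases hHan.eventually_constant_or_nhds_le_map_nhds with h | h
  · exfalso
    have h1 := hlim.eventually h
    obtain ⟨j, h1, h2, h3⟩ := (h1.and (hi.and (hsm hw))).exists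
    have h4 := (hφ _ h3 h2).2.1
    rw [h4, hHz] at h1
    apply h2; rw [h1]; simp
  · rw [hHz] at h
    rw [tendsto_def]
    intro V hV
    have hV' : V ∩ ball 0 r ∈ 𝓝 z := inter_mem hV (isOpen_ball.mem_nhds hzr)
    have h1 := hw' (h (image_mem_map hV'))
    filter_upwards [h1, hi', hsm hw'] with j h1 h2 h3
    obtain ⟨x, hx, hxe⟩ := h1
    have := (hφ _ h3 h2).2.2.1 x (ball_subset_closedBall hx.2) hxe
    change φ (w' j) ∈ V
    rw [← this]; exact hx.1

lemma fs_jump {r t : ℝ} {S : ℂ → ℂ} {K : Set ℂ} (ht : |t| < r / 2)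
    (hSc : ContinuousOn S (closedBall 0 r)) (hK : ∀ z ∈ K, S z = (starRingEnd ℂ) z)
    (hol : ∀ z ∈ closedBall (0:ℂ) r, z ∉ K → AnalyticAt ℂ S z)
    (hb : ∀ z ∈ closedBall (0:ℂ) r, ‖S z - z‖ ≤ ‖z‖ / 4)
    {φ : ℂ → ℂ} (hφ : ∀ w : ℂ, ‖w‖ < r / 2 → w.im ≠ 0 →
      ‖φ w‖ < r ∧ (φ w + S (φ w)) / 2 = w ∧
      (∀ z ∈ closedBall (0:ℂ) r, (z + S z) / 2 = w → z = φ w) ∧ DifferentiableAt ℂ φ w) :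
    Tendsto (fun ε : ℝ => (φ (t + ε * Complex.I)).re - (φ (t - ε * Complex.I)).re)
      (𝓝[>] 0) (𝓝 0) := by
  rw [tendsto_iff_ultrafilter]
  intro U hU
  have hw : Tendsto (fun ε : ℝ => (t:ℂ) + ε * Complex.I) U (𝓝 t) := by
    have : Continuous (fun ε : ℝ => (t:ℂ) + ε * Complex.I) := by fun_prop
    have h := this.tendsto 0
    simp at h
    exact h.mono_left (hU.trans nhdsWithin_le_nhds)
  have hw' : Tendsto (fun ε : ℝ => (t:ℂ) - ε * Complex.I) U (𝓝 t) := by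
    have : Continuous (fun ε : ℝ => (t:ℂ) - ε * Complex.I) := by fun_prop
    have h := this.tendsto 0
    simp at h
    exact h.mono_left (hU.trans nhdsWithin_le_nhds)
  have hpos : ∀ᶠ ε : ℝ in U, 0 < ε := hU self_mem_nhdsWithin
  have hi : ∀ᶠ ε : ℝ in U, ((t:ℂ) + ε * Complex.I).im ≠ 0 := by
    filter_upwards [hpos] with ε h
    simp [h.ne']
  have hi' : ∀ᶠ ε : ℝ in U, ((t:ℂ) - ε * Complex.I).im ≠ 0 := by
    filter_upwards [hpos] with ε h
    simp [h.ne']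
  have key : ∀ {v : ℝ → ℂ}, Tendsto v U (𝓝 (t:ℂ)) → (∀ᶠ ε : ℝ in U, (v ε).im ≠ 0) →
      ∃ z ∈ closedBall (0:ℂ) r, Tendsto (fun ε => φ (v ε)) U (𝓝 z) ∧ (z + S z) / 2 = t := by
    intro v hv hvi
    have hsm : ∀ᶠ j in U, ‖v j‖ < r / 2 := by
      apply hv.norm.eventually_lt_const
      simpa using ht
    have hmem : ∀ᶠ j in U, φ (v j) ∈ closedBall (0:ℂ) r := by
      filter_upwards [hvi, hsm] with j h1 h2
      simpa using (hφ _ h2 h1).1.le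
    obtain ⟨z, hz, hle⟩ := isCompact_iff_ultrafilter_le_nhds.1 (isCompact_closedBall (0:ℂ) r)
      (U.map (fun ε => φ (v ε))) (by
        rw [le_principal_iff]; exact hmem)
    have hlim : Tendsto (fun ε => φ (v ε)) U (𝓝 z) := hle
    refine ⟨z, hz, hlim, ?_⟩
    have hHc : ContinuousWithinAt (fun z => (z + S z) / 2) (closedBall 0 r) z :=
      ((continuousOn_id.add hSc).div_const 2) z hz
    have h1 : Tendsto (fun ε => (φ (v ε) + S (φ (v ε))) / 2) U (𝓝 ((z + S z) / 2)) :=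
      hHc.tendsto.comp (tendsto_nhdsWithin_iff.2 ⟨hlim, hmem⟩)
    refine tendsto_nhds_unique h1 (hv.congr' ?_)
    filter_upwards [hvi, hsm] with j h1 h2
    exact (hφ _ h2 h1).2.1.symm
  obtain ⟨z, hz, hzl, hzt⟩ := key hw hi
  obtain ⟨z', hz', hzl', hzt'⟩ := key hw' hi'
  have hre : z.re = z'.re := by
    by_cases h : z ∈ K
    · by_cases h' : z' ∈ K
      · rw [fs_real_of_K hK h] at hzt
        rw [fs_real_of_K hK h', ← hzt] at hzt'
        exact_mod_cast hzt'.symm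
      · have := fs_open_map ht hol hb hφ hw' hw hi' hi hz' h' hzt' hzl'
        rw [tendsto_nhds_unique hzl this]
    · have := fs_open_map ht hol hb hφ hw hw' hi hi' hz h hzt hzl
      rw [tendsto_nhds_unique hzl' this]
  have h1 := (Complex.continuous_re.tendsto z).comp hzl
  have h2 := (Complex.continuous_re.tendsto z').comp hzl'
  have h3 := h1.sub h2
  rw [hre, sub_self] at h3
  exact h3

lemma fs_reg {r : ℝ} {S : ℂ → ℂ} {K : Set ℂ}
    (hSc : ContinuousOn S (closedBall 0 r)) (hK : ∀ z ∈ K, S z = (starRingEnd ℂ) z)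
    (hol : ∀ z ∈ closedBall (0:ℂ) r, z ∉ K → AnalyticAt ℂ S z)
    {φ : ℂ → ℂ} (hφ : ∀ w : ℂ, ‖w‖ < r / 2 → w.im ≠ 0 →
      ‖φ w‖ < r ∧ (φ w + S (φ w)) / 2 = w ∧
      (∀ z ∈ closedBall (0:ℂ) r, (z + S z) / 2 = w → z = φ w) ∧ DifferentiableAt ℂ φ w)
    {z0 κ : ℂ} (hz0 : ‖z0‖ < r / 2) (hκ : κ ≠ -1)
    (hexp : ∀ ε > 0, ∃ ρ > 0, ∀ ζ : ℂ, ‖ζ‖ ≤ ρ →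
      ‖S (z0 + ζ) - (starRingEnd ℂ) z0 - κ * ζ‖ ≤ ε * ‖ζ‖)
    {v : ℝ → ℂ} {l : Filter ℝ} (hv : Tendsto v l (𝓝 (z0.re : ℂ)))
    (hvi : ∀ᶠ ε : ℝ in l, (v ε).im ≠ 0) : Tendsto (fun ε => φ (v ε)) l (𝓝 z0) := by
  set c : ℂ := (1 + κ) / 2 with hc
  have hc0 : c ≠ 0 := by
    intro h
    apply hκ
    rw [hc, div_eq_zero_iff] at h
    rcases h with h | h
    · linear_combination h
    · norm_num at h
  have hcp : 0 < ‖c‖ := norm_pos_iff.2 hc0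
  rw [Metric.tendsto_nhds]
  intro δ hδ
  obtain ⟨ρ0, hρ0, hρ⟩ := hexp ‖c‖ hcp
  set ρ := min (min ρ0 (δ / 2)) (r / 2 - ‖z0‖) with hρd
  have hρp : 0 < ρ := lt_min (lt_min hρ0 (by linarith)) (by linarith)
  have hρ1 : ρ ≤ ρ0 := (min_le_left _ _).trans (min_le_left _ _)
  have hρ2 : ρ ≤ δ / 2 := (min_le_left _ _).trans (min_le_right _ _)
  have hρ3 : ρ ≤ r / 2 - ‖z0‖ := min_le_right _ _
  have hr : 0 < r := by linarith [norm_nonneg z0]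
  have hsm : ∀ᶠ j in l, ‖v j‖ < r / 2 := by
    apply hv.norm.eventually_lt_const
    refine lt_of_le_of_lt ?_ hz0
    simpa using Complex.abs_re_le_norm z0
  have hcl : ∀ᶠ j in l, ‖v j - z0.re‖ < ‖c‖ * ρ / 2 := by
    have := Metric.tendsto_nhds.1 hv (‖c‖ * ρ / 2) (by positivity)
    simpa [dist_eq_norm] using this
  have hsub : ∀ ζ ∈ closedBall (0:ℂ) ρ, z0 + ζ ∈ closedBall (0:ℂ) r := by
    intro ζ hζ
    simp at hζ ⊢
    exact (norm_add_le _ _).trans (by linarith)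
  filter_upwards [hvi, hsm, hcl] with j h1 h2 h3
  obtain ⟨a, ha, ha0, -⟩ := fs_count1 hρp (f := fun ζ => ((z0 + ζ) + S (z0 + ζ)) / 2 - v j) (c := c)
    (by
      refine ContinuousOn.sub (ContinuousOn.div_const (ContinuousOn.add (by fun_prop) ?_) 2)
        continuousOn_const
      exact hSc.comp (by fun_prop) hsub) (by
      intro ζ hζ h0
      have hoff : z0 + ζ ∉ K := by
        intro hmem
        have h0' : ((z0 + ζ) + S (z0 + ζ)) / 2 = v j := sub_eq_zero.1 h0
        rw [fs_real_of_K hK hmem] at h0'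
        apply h1; rw [← h0']; simp
      have hA := hol _ (hsub ζ hζ) hoff
      have hA' : AnalyticAt ℂ (fun ζ => S (z0 + ζ)) ζ :=
        AnalyticAt.comp (g := S) (f := fun ζ => z0 + ζ) hA (by fun_prop)
      fun_prop) (by
      intro ζ hζ
      have hζρ : ‖ζ‖ = ρ := by simpa using hζ
      have h4 := hρ ζ (by linarith)
      have h5 : ((z0 + ζ) + S (z0 + ζ)) / 2 - v j - c * ζ =
          (S (z0 + ζ) - (starRingEnd ℂ) z0 - κ * ζ) / 2 - (v j - z0.re) := by
        have := Complex.add_conj z0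
        push_cast at this
        rw [hc]; linear_combination this / 2
      rw [h5]
      refine lt_of_le_of_lt (norm_sub_le _ _) ?_
      rw [norm_div, Complex.norm_ofNat]
      rw [hζρ] at h4
      nlinarith)
  have h6 := (hφ _ h2 h1).2.2.1 (z0 + a) (hsub a (ball_subset_closedBall ha)) (sub_eq_zero.1 ha0)
  rw [← h6]
  simp at ha ⊢
  linarith

lemma fs_norm_const {Q : ℂ → ℂ} {z : ℂ} (hQ : AnalyticAt ℂ Q z) (h1 : ∀ᶠ y in 𝓝 z, ‖Q y‖ = 1) :
    ∀ᶠ y in 𝓝 z, Q y = Q z := by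
  rcases hQ.eventually_constant_or_nhds_le_map_nhds with h | h
  · exact h
  · exfalso
    have h2 : ∀ᶠ q in 𝓝 (Q z), ‖q‖ = 1 := h h1
    have h3 : Tendsto (fun t : ℝ => (t : ℂ) * Q z) (𝓝[>] 1) (𝓝 (Q z)) := by
      have : Continuous (fun t : ℝ => (t : ℂ) * Q z) := by fun_prop
      have h := this.tendsto 1
      simp at h
      exact h.mono_left nhdsWithin_le_nhds
    obtain ⟨t, ht, ht1⟩ := ((h3.eventually h2).and self_mem_nhdsWithin).exists
    have ht1' : (1:ℝ) < t := ht1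
    rw [norm_mul, h1.self_of_nhds, mul_one, Complex.norm_real, Real.norm_eq_abs,
      abs_of_pos (by linarith)] at ht
    linarith

lemma fs_excl {r : ℝ} (hr : 0 < r) {S : ℂ → ℂ} {K : Set ℂ}
    (hSc : ContinuousOn S (closedBall 0 r)) (hK : ∀ z ∈ K, S z = (starRingEnd ℂ) z)
    (hol : ∀ z ∈ closedBall (0:ℂ) r, z ∉ K → AnalyticAt ℂ S z)
    (hb : ∀ z ∈ closedBall (0:ℂ) r, ‖S z - z‖ ≤ ‖z‖ / 4)
    {z0 κ : ℂ} (hz0 : ‖z0‖ < r / 16) 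
    (hexp : ∀ ε > 0, ∃ ρ > 0, ∀ ζ : ℂ, ‖ζ‖ ≤ ρ →
      ‖S (z0 + ζ) - (starRingEnd ℂ) z0 - κ * ζ‖ ≤ ε * ‖ζ‖) : κ ≠ -1 := by
  rintro rfl
  let Q : ℂ → ℂ := fun z => if z = z0 then -1 else (S z - (starRingEnd ℂ) z0) / (z - z0)
  have hQ0 : Q z0 = -1 := by simp [Q]
  have hQn : ∀ z, z ≠ z0 → Q z = (S z - (starRingEnd ℂ) z0) / (z - z0) := by
    intro z hz; simp [Q, hz]
  have hQe : ∀ z, z ≠ z0 → Q =ᶠ[𝓝 z] fun z => (S z - (starRingEnd ℂ) z0) / (z - z0) := by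
    intro z hz
    filter_upwards [isOpen_ne.mem_nhds hz] with y hy
    exact hQn y hy
  have hQK : ∀ z ∈ K, ‖Q z‖ = 1 := by
    intro z hz
    by_cases h : z = z0
    · rw [h, hQ0]; simp
    · rw [hQn z h, hK z hz, ← map_sub, norm_div, RCLike.norm_conj, div_self]
      exact norm_ne_zero_iff.2 (sub_ne_zero.2 h)
  have hQan : ∀ z ∈ closedBall (0:ℂ) r, z ∉ K → z ≠ z0 → AnalyticAt ℂ Q z := by
    intro z hz hzK h
    refine AnalyticAt.congr ?_ (hQe z h).symm
    exact ((hol z hz hzK).sub analyticAt_const).div (by fun_prop) (sub_ne_zero.2 h)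
  have hQat : ContinuousAt Q z0 := by
    rw [Metric.continuousAt_iff]
    intro ε hε
    obtain ⟨ρ, hρ, h⟩ := hexp (ε / 2) (by positivity)
    refine ⟨ρ, hρ, fun {z} hz => ?_⟩
    by_cases h1 : z = z0
    · rw [h1]; simpa using hε
    · have h2 := h (z - z0) (by rw [← dist_eq_norm]; exact hz.le)
      have h3 : z - z0 ≠ 0 := sub_ne_zero.2 h1
      have h3' : 0 < ‖z - z0‖ := norm_pos_iff.2 h3
      rw [add_sub_cancel] at h2
      have h4 : Q z - Q z0 = (S z - (starRingEnd ℂ) z0 - -1 * (z - z0)) / (z - z0) := by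
        rw [hQ0, hQn z h1]; field_simp
      rw [dist_eq_norm, h4, norm_div, div_lt_iff₀ h3']
      nlinarith
  have hQc : ContinuousOn Q (closedBall 0 r) := by
    intro z hz
    by_cases h : z = z0
    · subst h; exact hQat.continuousWithinAt
    · refine ContinuousWithinAt.congr_of_eventuallyEq ?_
        ((hQe z h).filter_mono nhdsWithin_le_nhds) (hQe z h).self_of_nhds
      exact ((hSc z hz).sub continuousWithinAt_const).div (by fun_prop) (sub_ne_zero.2 h)
  have hfar : ∀ z ∈ closedBall (0:ℂ) r, r / 2 ≤ ‖z‖ → ‖Q z - 1‖ < 1 := by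
    intro z hz hzr
    have h1 : z ≠ z0 := by
      rintro rfl; linarith
    have h3 : z - z0 ≠ 0 := sub_ne_zero.2 h1
    have h3' : 0 < ‖z - z0‖ := norm_pos_iff.2 h3
    have h4 : Q z - 1 = ((S z - z) - ((starRingEnd ℂ) z0 - z0)) / (z - z0) := by
      rw [hQn z h1]; field_simp; ring
    rw [h4, norm_div, div_lt_one h3']
    have h5 := hb z hz
    have h6 := norm_sub_le (S z - z) ((starRingEnd ℂ) z0 - z0)
    have h7 := norm_sub_le ((starRingEnd ℂ) z0) z0
    have h8 := norm_sub_norm_le z z0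
    rw [RCLike.norm_conj] at h7
    linarith
  have hval : ∀ z ∈ closedBall (0:ℂ) r, ‖Q z + 1‖ < 1 → ‖Q z‖ = 1 := by
    intro z hz h1
    by_contra hne
    refine fs_count0 hr (f := fun y => Q y - Q z) (c := 1 - Q z) (hQc.sub continuousOn_const)
      ?_ ?_ z hz (sub_self _)
    · intro y hy h0
      have h2 : Q y = Q z := sub_eq_zero.1 h0
      refine (hQan y hy ?_ ?_).sub analyticAt_const
      · intro hyK
        apply hne; rw [← h2]; exact hQK y hyK
      · rintro rfl
        apply hne; rw [← h2, hQ0]; simp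
    · intro y hy
      have h2 := hfar y (sphere_subset_closedBall hy) (by
        have : ‖y‖ = r := by simpa using hy
        linarith)
      have h3 : Q y - Q z - (1 - Q z) = Q y - 1 := by ring
      have h4 : (2:ℂ) = (1 - Q z) + (Q z + 1) := by ring
      have h5 := norm_add_le (1 - Q z) (Q z + 1)
      rw [← h4] at h5
      simp at h5
      rw [h3]; linarith
  -- a point on the horizontal ray
  let J : Set ℂ := {z | z.im = z0.im ∧ z0.re < z.re} ∩ ball 0 r
  have hJ : IsPreconnected J := by
    apply Convex.isPreconnected
    refine Convex.inter ?_ (convex_ball _ _)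
    exact (convex_hyperplane (Complex.imLm.isLinear) z0.im).inter
      (convex_halfSpace_re_gt z0.re)
  have hJK : ∀ z ∈ J, z ∈ K → Q z = 1 := by
    rintro z ⟨⟨h1, h2⟩, h3⟩ hzK
    have h4 : z ≠ z0 := by rintro rfl; exact lt_irrefl _ h2
    rw [hQn z h4, hK z hzK, ← map_sub, div_eq_one_iff_eq (sub_ne_zero.2 h4),
      Complex.conj_eq_iff_im]
    simp [h1]
  have hnear : ∀ᶠ z in 𝓝 z0, ‖Q z + 1‖ < 1 / 2 := by
    have := Metric.tendsto_nhds.1 hQat (1/2) (by norm_num)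
    filter_upwards [this] with z hz
    rw [dist_eq_norm, hQ0, sub_neg_eq_add] at hz
    exact hz
  have hball0 : z0 ∈ ball (0:ℂ) r := by
    simp; linarith
  have hray : Tendsto (fun x : ℝ => z0 + x) (𝓝[>] 0) (𝓝 z0) := by
    have : Continuous (fun x : ℝ => z0 + (x:ℂ)) := by fun_prop
    have h := this.tendsto 0
    simp only [Complex.ofReal_zero, add_zero] at h
    exact h.mono_left nhdsWithin_le_nhds
  obtain ⟨x, ⟨hx1, hx2⟩, hx3⟩ := (((hray.eventually hnear.eventually_nhds).and
    (hray.eventually (isOpen_ball.mem_nhds hball0))).and self_mem_nhdsWithin).exists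
  have hx3' : (0:ℝ) < x := hx3
  set z1 : ℂ := z0 + x with hz1
  set c1 := Q z1 with hc1
  have hc1n : ‖c1 + 1‖ < 1 / 2 := hx1.self_of_nhds
  have hc11 : ∀ q : ℂ, ‖q - 1‖ < 1 → q ≠ c1 := by
    rintro q hq rfl
    have h4 : (2:ℂ) = (c1 + 1) - (c1 - 1) := by ring
    have h5 := norm_sub_le (c1 + 1) (c1 - 1)
    rw [← h4] at h5
    simp at h5
    linarith
  have hJne : ∀ z ∈ J, z ≠ z0 := by
    rintro z ⟨⟨h1, h2⟩, h3⟩ rfl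
    exact lt_irrefl _ h2
  have hJan : ∀ z ∈ J, Q z = c1 → AnalyticAt ℂ Q z := by
    intro z hz h
    refine hQan z (ball_subset_closedBall hz.2) (fun hzK => ?_) (hJne z hz)
    exact hc11 1 (by simp) ((hJK z hz hzK).symm.trans h)
  have hz1J : z1 ∈ J := ⟨⟨by simp [hz1], by simpa [hz1] using hx3'⟩, hx2⟩
  let T : Set ℂ := {z | ∀ᶠ y in 𝓝 z, Q y = c1}
  have hTo : IsOpen T := isOpen_iff_mem_nhds.2 fun z hz => (eventually_eventually_nhds.2 hz)
  have hz1T : z1 ∈ T := by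
    refine fs_norm_const (hJan z1 hz1J rfl) ?_
    filter_upwards [hx1, isOpen_ball.mem_nhds hx2] with y hy1 hy2
    exact hval y (ball_subset_closedBall hy2) (by linarith)
  have hsub : J ⊆ T := by
    refine hJ.subset_of_closure_inter_subset hTo ⟨z1, hz1J, hz1T⟩ ?_
    rintro z ⟨hz1, hz2⟩
    rw [mem_closure_iff_frequently] at hz1
    have hQz : Q z = c1 := by
      have hcz : ContinuousAt Q z := hQc.continuousAt (closedBall_mem_nhds_of_mem hz2.2)
      by_contra hne
      obtain ⟨y, hy1, hy2⟩ := (hz1.and_eventually (hcz.eventually_ne hne)).exists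
      exact hy2 hy1.self_of_nhds
    rcases (hJan z hz2 hQz).eventually_eq_or_eventually_ne (analyticAt_const (v := c1)) with h | h
    · exact h
    · exfalso
      rw [eventually_nhdsWithin_iff] at h
      obtain ⟨y, hyW, hy⟩ := (hz1.and_eventually h.eventually_nhds).exists
      have h3 : ∀ᶠ x in 𝓝 y, x = z := by
        filter_upwards [hyW, hy] with x hx1 hx2
        by_contra hne
        exact hx2 hne hx1
      exact (infinite_of_mem_nhds y h3) (Set.finite_singleton z)
  have h34 : ‖((3 * r / 4 : ℝ) : ℂ)‖ = 3 * r / 4 := by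
    rw [Complex.norm_real, Real.norm_eq_abs, abs_of_pos (by positivity)]
  have hlast : z0 + ((3 * r / 4 : ℝ) : ℂ) ∈ ball (0:ℂ) r := by
    rw [mem_ball, dist_zero_right]
    refine lt_of_le_of_lt (norm_add_le _ _) ?_
    rw [h34]; linarith
  have hlJ : z0 + ((3 * r / 4 : ℝ) : ℂ) ∈ J := by
    refine ⟨⟨by simp, ?_⟩, hlast⟩
    rw [Complex.add_re, Complex.ofReal_re]; linarith
  refine hc11 _ (hfar _ (ball_subset_closedBall hlast) ?_) (hsub hlJ).self_of_nhds
  have := norm_sub_le (z0 + ((3 * r / 4 : ℝ) : ℂ)) z0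
  rw [add_sub_cancel_left, h34] at this
  linarith

theorem fs_complex {R : ℝ} (hR : 0 < R) {S : ℂ → ℂ} {K : Set ℂ}
    (hSc : ContinuousOn S (ball 0 R)) (hK : ∀ z ∈ K, S z = (starRingEnd ℂ) z)
    (hol : ∀ z ∈ ball (0:ℂ) R, z ∉ K → AnalyticAt ℂ S z)
    (h0 : ∀ ε > 0, ∃ r > 0, ∀ z : ℂ, ‖z‖ ≤ r → ‖S z - z‖ ≤ ε * ‖z‖) :
    ∃ s > 0, ∃ F : ℂ → ℂ, DifferentiableOn ℂ F (ball 0 s) ∧ ∀ z ∈ ball (0:ℂ) s, ∀ κ : ℂ,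
      (∀ ε > 0, ∃ ρ > 0, ∀ ζ : ℂ, ‖ζ‖ ≤ ρ →
        ‖S (z + ζ) - (starRingEnd ℂ) z - κ * ζ‖ ≤ ε * ‖ζ‖) → z.im = (F z.re).im / 2 := by
  obtain ⟨r0, hr0, hr1⟩ := h0 (1 / 4) (by norm_num)
  set r := min r0 (R / 2) with hrd
  have hr : 0 < r := lt_min hr0 (by linarith)
  have hsubR : closedBall (0:ℂ) r ⊆ ball 0 R :=
    closedBall_subset_ball (lt_of_le_of_lt (min_le_right _ _) (by linarith))
  have hSc' := hSc.mono hsubR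
  have hol' : ∀ z ∈ closedBall (0:ℂ) r, z ∉ K → AnalyticAt ℂ S z :=
    fun z hz => hol z (hsubR hz)
  have hb : ∀ z ∈ closedBall (0:ℂ) r, ‖S z - z‖ ≤ ‖z‖ / 4 := by
    intro z hz
    have := hr1 z (by simp at hz; exact hz.trans (min_le_left _ _))
    linarith
  obtain ⟨φ, hφ⟩ := fs_phi hr hSc' hK hol' hb
  let F0 : ℂ → ℂ := fun w => φ w - (starRingEnd ℂ) (φ ((starRingEnd ℂ) w))
  have hcb : ∀ w ∈ ball (0:ℂ) (r/2), ‖w‖ < r / 2 ∧ ‖(starRingEnd ℂ) w‖ < r / 2 := by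
    intro w hw
    rw [RCLike.norm_conj]
    simpa using hw
  have hci : ∀ w : ℂ, w.im ≠ 0 → ((starRingEnd ℂ) w).im ≠ 0 := by
    intro w hw; simpa using hw
  obtain ⟨F, hF1, hF2⟩ := fs_reflect (s := r / 2) (by linarith) (F0 := F0)
    (M := ⟨r + r, by linarith⟩) (by
      intro w hw hi
      have h1 := (hφ w (hcb w hw).1 hi).2.2.2
      have h2 := (hφ _ (hcb w hw).2 (hci w hi)).2.2.2
      have h3 := h2.conj_conj
      rw [Complex.conj_conj] at h3
      exact h1.sub h3) (by
      intro w hw hi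
      have h1 := (hφ w (hcb w hw).1 hi).1
      have h2 := (hφ _ (hcb w hw).2 (hci w hi)).1
      refine (norm_sub_le _ _).trans ?_
      rw [RCLike.norm_conj]
      change _ ≤ r + r
      linarith) (by
      intro t ht
      have h1 := fs_jump ht hSc' hK hol' hb hφ
      have h2 := (Complex.continuous_ofReal.tendsto _).comp (h1.const_mul 2)
      simp only [mul_zero, Complex.ofReal_zero] at h2
      refine h2.congr fun ε => ?_
      have e1 : (starRingEnd ℂ) ((t:ℂ) + ε * Complex.I) = t - ε * Complex.I := by
        simp [sub_eq_add_neg]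
      have e2 : (starRingEnd ℂ) ((t:ℂ) - ε * Complex.I) = t + ε * Complex.I := by
        simp 
      simp only [F0, e1, e2, Function.comp]
      have a1 := Complex.add_conj (φ (t + ε * Complex.I))
      have a2 := Complex.add_conj (φ (t - ε * Complex.I))
      push_cast at a1 a2 ⊢
      linear_combination a2 - a1)
  refine ⟨r / 16, by linarith, F, hF1.mono (ball_subset_ball (by linarith)), ?_⟩
  intro z hz κ hexp
  have hzn : ‖z‖ < r / 16 := by simpa using hz
  have hκ := fs_excl hr hSc' hK hol' hb hzn hexp
  have hzn2 : ‖z‖ < r / 2 := by linarith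
  have hw : Tendsto (fun ε : ℝ => (z.re:ℂ) + ε * Complex.I) (𝓝[>] 0) (𝓝 z.re) := by
    have : Continuous (fun ε : ℝ => (z.re:ℂ) + ε * Complex.I) := by fun_prop
    have h := this.tendsto 0
    simp at h
    exact h.mono_left (nhdsWithin_le_nhds)
  have hw' : Tendsto (fun ε : ℝ => (z.re:ℂ) - ε * Complex.I) (𝓝[>] 0) (𝓝 z.re) := by
    have : Continuous (fun ε : ℝ => (z.re:ℂ) - ε * Complex.I) := by fun_prop
    have h := this.tendsto 0
    simp at h
    exact h.mono_left (nhdsWithin_le_nhds)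
  have hpos : ∀ᶠ ε : ℝ in 𝓝[>] 0, 0 < ε := self_mem_nhdsWithin
  have hi : ∀ᶠ ε : ℝ in 𝓝[>] 0, ((z.re:ℂ) + ε * Complex.I).im ≠ 0 := by
    filter_upwards [hpos] with ε h
    simp [h.ne']
  have hi' : ∀ᶠ ε : ℝ in 𝓝[>] 0, ((z.re:ℂ) - ε * Complex.I).im ≠ 0 := by
    filter_upwards [hpos] with ε h
    simp [h.ne']
  have l1 := fs_reg hSc' hK hol' hφ hzn2 hκ hexp hw hi
  have l2 := fs_reg hSc' hK hol' hφ hzn2 hκ hexp hw' hi'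
  have l3 := l1.sub ((Complex.continuous_conj.tendsto z).comp l2)
  have hzre : (z.re : ℂ) ∈ ball (0:ℂ) (r / 2) := by
    simp
    exact lt_of_le_of_lt (Complex.abs_re_le_norm z) hzn2
  have hFc : ContinuousAt F (z.re : ℂ) := (hF1.differentiableAt (isOpen_ball.mem_nhds hzre)).continuousAt
  have l4 : Tendsto (fun ε : ℝ => F ((z.re:ℂ) + ε * Complex.I)) (𝓝[>] 0) (𝓝 (F z.re)) :=
    hFc.tendsto.comp hw
  have heq : F z.re = z - (starRingEnd ℂ) z := by
    refine tendsto_nhds_unique l4 (l3.congr' ?_)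
    filter_upwards [hi, hw.eventually (isOpen_ball.mem_nhds hzre)] with ε h1 h2
    rw [hF2 _ h2 h1]
    have e1 : (starRingEnd ℂ) ((z.re:ℂ) + ε * Complex.I) = z.re - ε * Complex.I := by
      simp [sub_eq_add_neg]
    simp only [F0, e1, Function.comp]
  rw [heq]
  simp

lemma fs_weyl_global {f : ℂ → ℂ} {L : ℝ≥0} (hf : LipschitzWith L f) {c : ℂ} {R : ℝ} (hR : 0 < R)
    (hd : ∀ᵐ z : ℂ, z ∈ ball c R → DifferentiableAt ℂ f z) :
    DifferentiableOn ℂ f (ball c (R / 2)) := by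
  have hfc : Continuous f := hf.continuous
  let μ : ℕ → Measure ℂ := fun n => ProbabilityTheory.cond volume (ball (0:ℂ) (1 / ((n:ℝ) + 1)))
  have hδ : ∀ n : ℕ, 0 < 1 / ((n:ℝ) + 1) := fun n => by positivity
  have hμ : ∀ n, IsProbabilityMeasure (μ n) := fun n =>
    ProbabilityTheory.cond_isProbabilityMeasure_of_finite (measure_ball_pos _ _ (hδ n)).ne'
      measure_ball_lt_top.ne
  have hmem : ∀ n : ℕ, ∀ᵐ w ∂(μ n), w ∈ ball (0:ℂ) (1 / ((n:ℝ) + 1)) := fun n =>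
    ProbabilityTheory.ae_cond_of_forall_mem measurableSet_ball fun x hx => hx
  have hac : ∀ n, μ n ≪ volume := fun n => ProbabilityTheory.cond_absolutelyContinuous
  have hinteg : ∀ n z, Integrable (fun w => f (z + w)) (μ n) := by
    intro n z
    have hm : AEStronglyMeasurable (fun w => f (z + w)) (μ n) :=
      (hfc.comp (continuous_const.add continuous_id)).aestronglyMeasurable
    refine Integrable.of_bound hm (‖f z‖ + L * (1 / ((n:ℝ) + 1))) ?_
    filter_upwards [hmem n] with w hw
    have h1 := hf.norm_sub_le (z + w) z
    have h2 : ‖w‖ < 1 / ((n:ℝ) + 1) := by simpa using hw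
    have h3 : ‖f (z + w)‖ ≤ ‖f z‖ + ‖f (z + w) - f z‖ := by
      have := norm_add_le (f z) (f (z + w) - f z)
      simpa using this
    rw [add_sub_cancel_left] at h1
    have h4 : (L:ℝ) * ‖w‖ ≤ L * (1 / ((n:ℝ) + 1)) := by gcongr
    linarith
  have hlim : Tendsto (fun n : ℕ => (L:ℝ) * (1 / ((n:ℝ) + 1))) atTop (𝓝 0) := by
    simpa using (tendsto_one_div_add_atTop_nhds_zero_nat (𝕜 := ℝ)).const_mul (L:ℝ)
  have hconv : TendstoUniformlyOn (fun n z => ∫ w, f (z + w) ∂(μ n)) f atTop (ball c (R / 2)) := by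
    rw [Metric.tendstoUniformlyOn_iff]
    intro ε hε
    filter_upwards [hlim.eventually (gt_mem_nhds hε)] with n hn z _
    have : f z - ∫ w, f (z + w) ∂(μ n) = ∫ w, (f z - f (z + w)) ∂(μ n) := by
      rw [integral_sub (integrable_const _) (hinteg n z)]
      simp
    rw [dist_eq_norm, this]
    refine lt_of_le_of_lt ?_ hn
    have := norm_integral_le_of_norm_le_const (μ := μ n) (f := fun w => f z - f (z + w))
      (C := (L:ℝ) * (1 / ((n:ℝ) + 1))) ?_
    · simpa using this
    · filter_upwards [hmem n] with w hw
      have h1 := hf.norm_sub_le z (z + w)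
      have h2 : ‖w‖ < 1 / ((n:ℝ) + 1) := by simpa using hw
      have h3 : ‖z - (z + w)‖ = ‖w‖ := by rw [← norm_neg]; congr 1; ring
      rw [h3] at h1
      exact h1.trans (by gcongr)
  refine hconv.tendstoLocallyUniformlyOn.differentiableOn ?_ isOpen_ball
  filter_upwards [(tendsto_one_div_add_atTop_nhds_zero_nat (𝕜 := ℝ)).eventually
    (gt_mem_nhds (half_pos hR))] with n hn
  intro z hz
  refine DifferentiableAt.differentiableWithinAt ?_
  have key := hasDerivAt_integral_of_dominated_loc_of_lip (𝕜 := ℂ) (μ := μ n)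
    (F := fun z w => f (z + w)) (F' := fun w => deriv f (z + w)) (x₀ := z) (s := univ)
    (bound := fun _ => (L:ℝ)) univ_mem
    (Eventually.of_forall fun x => (hinteg n x).aestronglyMeasurable) (hinteg n z)
    (((stronglyMeasurable_deriv f).comp_measurable (measurable_const_add z)).aestronglyMeasurable)
    (Eventually.of_forall fun w => ?_) (integrable_const _) ?_
  · exact key.2.differentiableAt
  · have h0 : Real.nnabs (L:ℝ) = L := by ext; simp
    change LipschitzOnWith (Real.nnabs (L:ℝ)) _ _
    rw [h0]
    refine LipschitzWith.lipschitzOnWith ?_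
    refine LipschitzWith.of_dist_le_mul fun x y => ?_
    simpa using hf.dist_le_mul (x + w) (y + w)
  · have h1 : ∀ᵐ w : ℂ, z + w ∈ ball c R → DifferentiableAt ℂ f (z + w) :=
      (measurePreserving_add_left (volume : Measure ℂ) z).quasiMeasurePreserving.ae hd
    filter_upwards [(hac n).ae_le h1, hmem n] with w hw hw2
    have h2 : ‖w‖ < 1 / ((n:ℝ) + 1) := by simpa using hw2
    have h3 : DifferentiableAt ℂ f (z + w) := by
      apply hw
      rw [mem_ball, dist_eq_norm] at hz ⊢
      calc ‖z + w - c‖ = ‖(z - c) + w‖ := by congr 1; ring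
        _ ≤ ‖z - c‖ + ‖w‖ := norm_add_le _ _
        _ < R := by linarith
    exact HasDerivAt.comp_add_const z w h3.hasDerivAt

lemma fs_weyl {f : ℂ → ℂ} {L : ℝ≥0} {c : ℂ} {R : ℝ} (hR : 0 < R)
    (hf : LipschitzOnWith L f (ball c R))
    (hd : ∀ᵐ z : ℂ, z ∈ ball c R → DifferentiableAt ℂ f z) :
    AnalyticAt ℂ f c := by
  obtain ⟨g, hg, hfg⟩ := hf.extend_finite_dimension
  have heq : ∀ z ∈ ball c R, f =ᶠ[𝓝 z] g := fun z hz =>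
    hfg.eventuallyEq_of_mem (isOpen_ball.mem_nhds hz)
  have h1 := fs_weyl_global hg hR (hd.mono fun z hz hzb => (heq z hzb).differentiableAt_iff.1 (hz hzb))
  have h2 : AnalyticAt ℂ g c :=
    h1.analyticAt (isOpen_ball.mem_nhds (mem_ball_self (half_pos hR)))
  exact h2.congr (heq c (mem_ball_self hR)).symm

/-- The identification of `ℂ` with the Euclidean plane. -/
abbrev fsE : ℂ ≃ₗᵢ[ℝ] EuclideanSpace ℝ (Fin 2) := Complex.orthonormalBasisOneI.repr

/-- The Schwarz-type function associated with `u`. -/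
def fsS (u : EuclideanSpace ℝ (Fin 2) → ℝ) (z : ℂ) : ℂ :=
  (starRingEnd ℂ) z - 2 * ((gradient u (fsE z) 0 : ℂ) - Complex.I * (gradient u (fsE z) 1 : ℂ))

lemma fs_grad_zero {Ω : Set (EuclideanSpace ℝ (Fin 2))} (hΩ : IsOpen Ω)
    {u : EuclideanSpace ℝ (Fin 2) → ℝ} (hpos : ∀ x ∈ Ω, 0 ≤ u x)
    {x : EuclideanSpace ℝ (Fin 2)} (hx : x ∈ Ω) (h0 : u x = 0) : gradient u x = 0 := by
  have hmin : IsLocalMin u x := by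
    filter_upwards [hΩ.mem_nhds hx] with y hy
    rw [h0]; exact hpos y hy
  rw [gradient, hmin.fderiv_eq_zero, map_zero]

lemma fs_grad_interp {E : Type*} [NormedAddCommGroup E] [NormedSpace ℝ E]
    {v : E → ℝ} {w : E → E →L[ℝ] ℝ} {L : ℝ≥0} {δ : ℝ} (hδ : 0 < δ)
    (hv : ∀ h ∈ ball (0:E) δ, HasFDerivAt v (w h) h) (hL : LipschitzOnWith L w (ball 0 δ))
    (hq : ∀ ε > 0, ∃ ρ > 0, ∀ h : E, ‖h‖ ≤ ρ → |v h| ≤ ε * ‖h‖ ^ 2) :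
    ∀ ε > 0, ∃ ρ > 0, ∀ h : E, ‖h‖ ≤ ρ → ‖w h‖ ≤ ε * ‖h‖ := by
  intro ε hε
  obtain ⟨s, hs0, hs1, hsL⟩ : ∃ s : ℝ, 0 < s ∧ s ≤ 1 ∧ L * s ≤ ε / 2 := by
    refine ⟨min 1 (ε / (2 * (L + 1))), by positivity, min_le_left _ _, ?_⟩
    calc (L:ℝ) * min 1 (ε / (2 * (L + 1))) ≤ (L + 1) * (ε / (2 * (L + 1))) := by
          gcongr
          · linarith
          · exact min_le_right _ _
      _ = ε / 2 := by field_simp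
  obtain ⟨ρ, hρ, hqρ⟩ := hq (s * ε / 10) (by positivity)
  refine ⟨min (ρ / 2) (δ / 4), by positivity, fun h hh => ?_⟩
  have hh1 : ‖h‖ ≤ ρ / 2 := hh.trans (min_le_left _ _)
  have hh2 : ‖h‖ ≤ δ / 4 := hh.trans (min_le_right _ _)
  refine ContinuousLinearMap.opNorm_le_of_unit_norm (by positivity) ?_
  intro d hd
  set r := ‖h‖ with hr
  have hr0 : 0 ≤ r := norm_nonneg _
  set k : E := (s * r) • d with hk
  have hkn : ‖k‖ = s * r := by rw [hk, norm_smul, hd, mul_one, Real.norm_of_nonneg (by positivity)]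
  have hkr : ‖k‖ ≤ r := by rw [hkn]; nlinarith
  have hsub : closedBall h ‖k‖ ⊆ ball (0:E) δ := by
    intro y hy
    rw [mem_closedBall, dist_eq_norm] at hy
    rw [mem_ball_zero_iff]
    have : ‖y‖ ≤ ‖y - h‖ + ‖h‖ := by simpa using norm_add_le (y - h) h
    linarith
  have hhk : h ∈ closedBall h ‖k‖ := mem_closedBall_self (norm_nonneg _)
  have hT := Convex.norm_image_sub_le_of_norm_hasFDerivWithin_le' (f := v) (f' := w) (φ := w h)
    (C := L * ‖k‖) (s := closedBall h ‖k‖) (x := h) (y := h + k)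
    (fun x hx => (hv x (hsub hx)).hasFDerivWithinAt)
    (fun x hx => by
      have := hL.norm_sub_le (hsub hx) (hsub hhk)
      refine this.trans ?_
      gcongr
      rwa [mem_closedBall, dist_eq_norm] at hx)
    (convex_closedBall _ _) hhk (by simp [mem_closedBall, dist_eq_norm])
  rw [add_sub_cancel_left] at hT
  have h1 := hqρ h (by linarith)
  have hhkn : ‖h + k‖ ≤ 2 * r := by
    have := norm_add_le h k
    linarith
  have h2 := hqρ (h + k) (by linarith)
  have h2' : |v (h + k)| ≤ s * ε / 10 * (2 * r) ^ 2 := h2.trans (by gcongr)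
  have hwk : w h k = (s * r) * w h d := by rw [hk, map_smul, smul_eq_mul]
  rw [hwk, hkn, Real.norm_eq_abs] at hT
  rw [Real.norm_eq_abs]
  rcases eq_or_lt_of_le hr0 with hz | hz
  · have h0 : h = 0 := by rw [← norm_eq_zero, ← hr, ← hz]
    -- at the origin: use the little-o property directly
    have hder : HasFDerivAt v (0 : E →L[ℝ] ℝ) 0 := by
      have hv0 : v 0 = 0 := by
        have := hqρ 0 (by simpa using hρ.le)
        simpa using this
      rw [hasFDerivAt_iff_isLittleO_nhds_zero]
      rw [Asymptotics.isLittleO_iff]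
      intro c hc
      obtain ⟨ρ', hρ', hq'⟩ := hq c hc
      filter_upwards [ball_mem_nhds (0:E) (lt_min hρ' one_pos)] with y hy
      rw [mem_ball_zero_iff] at hy
      have ha : ‖y‖ ≤ ρ' := (hy.trans_le (min_le_left _ _)).le
      have hb : ‖y‖ ≤ 1 := (hy.trans_le (min_le_right _ _)).le
      have := hq' y ha
      simp only [zero_add, hv0, sub_zero, _root_.zero_apply, Real.norm_eq_abs]
      refine this.trans ?_
      have : ‖y‖ ^ 2 ≤ ‖y‖ := by nlinarith [norm_nonneg y]
      gcongr
    have := (hv 0 (mem_ball_self hδ)).unique hder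
    rw [h0, this, ← hz]; simp
  · have h3 : |s * r * w h d| ≤ L * (s * r) * (s * r) + s * ε / 10 * (2 * r) ^ 2
        + s * ε / 10 * r ^ 2 := by
      have e : s * r * w h d = -(v (h + k) - v h - s * r * w h d) + v (h + k) - v h := by ring
      rw [abs_le] at hT h2' h1 ⊢
      constructor <;> linarith [hT.1, hT.2, h2'.1, h2'.2, h1.1, h1.2]
    rw [abs_mul, abs_of_pos (by positivity : 0 < s * r)] at h3
    have h4 : s * r * |w h d| ≤ s * r * (ε * r) := by
      refine h3.trans ?_
      have : L * (s * r) * (s * r) = (L * s) * (s * r ^ 2) := by ring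
      rw [this]
      have : (L * s) * (s * r ^ 2) ≤ ε / 2 * (s * r ^ 2) := by gcongr
      nlinarith
    exact le_of_mul_le_mul_left h4 (by positivity)

lemma fs_blow_expand {u : EuclideanSpace ℝ (Fin 2) → ℝ} {y : EuclideanSpace ℝ (Fin 2)}
    {A : Matrix (Fin 2) (Fin 2) ℝ} (hA : IsBlowup u y A) (h0 : u y = 0) :
    ∀ ε > 0, ∃ ρ > 0, ∀ h, ‖h‖ ≤ ρ → |u (y + h) - quadForm A h| ≤ ε * ‖h‖ ^ 2 := by
  intro ε hε
  have h1 := (tendstoLocallyUniformly_iff_forall_isCompact.1 hA.2) (closedBall 0 1)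
    (isCompact_closedBall _ _)
  rw [Metric.tendstoUniformlyOn_iff] at h1
  have h2 := h1 ε hε
  obtain ⟨ρ, hρ, hs⟩ := mem_nhdsGT_iff_exists_Ioc_subset.1 h2
  refine ⟨ρ, hρ, fun h hh => ?_⟩
  rcases eq_or_lt_of_le (norm_nonneg h) with hz | hz
  · have : h = 0 := by rw [← norm_eq_zero, ← hz]
    subst this
    simp [h0, quadForm]
  · have h3 := hs ⟨hz, hh⟩ (‖h‖⁻¹ • h) (by
      rw [mem_closedBall_zero_iff, norm_smul, norm_inv, norm_norm, inv_mul_cancel₀ hz.ne'])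
    rw [smul_smul, mul_inv_cancel₀ hz.ne', one_smul, Real.dist_eq] at h3
    have h4 : quadForm A (‖h‖⁻¹ • h) = quadForm A h / ‖h‖ ^ 2 := by
      simp only [quadForm, Fin.sum_univ_two, PiLp.smul_apply, smul_eq_mul]
      field_simp
    rw [h4, ← sub_div, abs_div, abs_of_pos (by positivity : 0 < ‖h‖ ^ 2),
      div_lt_iff₀ (by positivity), abs_sub_comm] at h3
    exact h3.le

/-- The derivative of the quadratic form, as a bilinear map. -/
def fsW (a b c : ℝ) : EuclideanSpace ℝ (Fin 2) →L[ℝ] EuclideanSpace ℝ (Fin 2) →L[ℝ] ℝ :=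
  (EuclideanSpace.proj (𝕜 := ℝ) (0 : Fin 2)).smulRight
      (a • (EuclideanSpace.proj (𝕜 := ℝ) (0 : Fin 2)) + b • (EuclideanSpace.proj (𝕜 := ℝ) (1 : Fin 2)))
    + (EuclideanSpace.proj (𝕜 := ℝ) (1 : Fin 2)).smulRight
      (b • (EuclideanSpace.proj (𝕜 := ℝ) (0 : Fin 2)) + c • (EuclideanSpace.proj (𝕜 := ℝ) (1 : Fin 2)))

lemma fsW_apply (a b c : ℝ) (h d : EuclideanSpace ℝ (Fin 2)) :
    fsW a b c h d = h 0 * (a * d 0 + b * d 1) + h 1 * (b * d 0 + c * d 1) := by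
  simp [fsW]
  ring

lemma fs_quad_deriv {A : Matrix (Fin 2) (Fin 2) ℝ} (hs : A 1 0 = A 0 1)
    (h : EuclideanSpace ℝ (Fin 2)) :
    HasFDerivAt (quadForm A) (fsW (A 0 0) (A 0 1) (A 1 1) h) h := by
  have h0 : HasFDerivAt (fun x : EuclideanSpace ℝ (Fin 2) => x 0)
    (EuclideanSpace.proj (𝕜 := ℝ) (0 : Fin 2)) h :=
    (EuclideanSpace.proj (𝕜 := ℝ) (0 : Fin 2)).hasFDerivAt
  have h1 : HasFDerivAt (fun x : EuclideanSpace ℝ (Fin 2) => x 1)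
    (EuclideanSpace.proj (𝕜 := ℝ) (1 : Fin 2)) h :=
    (EuclideanSpace.proj (𝕜 := ℝ) (1 : Fin 2)).hasFDerivAt
  have := (((((h0.mul h0).const_mul (A 0 0)).add ((h0.mul h1).const_mul (2 * A 0 1))).add
    ((h1.mul h1).const_mul (A 1 1))).const_mul (1 / 2))
  have hq : quadForm A = fun y : EuclideanSpace ℝ (Fin 2) => 1 / 2 *
      (A 0 0 * (y 0 * y 0) + 2 * A 0 1 * (y 0 * y 1) + A 1 1 * (y 1 * y 1)) := by
    funext x
    simp only [quadForm, Fin.sum_univ_two, hs]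
    ring
  rw [hq]
  refine HasFDerivAt.congr_fderiv this ?_
  ext d
  simp [fsW_apply]
  ring

lemma fs_cr {u : EuclideanSpace ℝ (Fin 2) → ℝ} {z : ℂ}
    (hd : ∀ᶠ y in 𝓝 (fsE z), DifferentiableAt ℝ u y)
    (hg : DifferentiableAt ℝ (gradient u) (fsE z)) (hl : lapGrad u (fsE z) = 1) :
    DifferentiableAt ℂ (fsS u) z := by
  set G := fderiv ℝ (gradient u) (fsE z) with hG
  have hG' : HasFDerivAt (gradient u) G (fsE z) := hg.hasFDerivAt
  have hsym : ∀ v w : EuclideanSpace ℝ (Fin 2), inner ℝ (G v) w = inner ℝ (G w) v := by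
    intro v w
    have h2 : HasFDerivAt (fun y => InnerProductSpace.toDual ℝ _ (gradient u y))
        ((innerSL ℝ (E := EuclideanSpace ℝ (Fin 2))).comp G) (fsE z) :=
      (innerSL ℝ (E := EuclideanSpace ℝ (Fin 2))).hasFDerivAt.comp _ hG'
    have := second_derivative_symmetric_of_eventually
      (hd.mono fun y hy => hy.hasGradientAt.hasFDerivAt) h2 v w
    simpa using this
  have hs01 : G (EuclideanSpace.single 0 1) 1 = G (EuclideanSpace.single 1 1) 0 := by
    have := hsym (EuclideanSpace.single 0 1) (EuclideanSpace.single 1 1)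
    simpa [EuclideanSpace.inner_single_right] using this
  have htr : G (EuclideanSpace.single 0 1) 0 + G (EuclideanSpace.single 1 1) 1 = 1 := by
    simpa [lapGrad, Fin.sum_univ_two] using hl
  have he : HasFDerivAt (fun w : ℂ => fsE w) (fsE.toContinuousLinearEquiv : ℂ →L[ℝ] _) z :=
    fsE.toContinuousLinearEquiv.hasFDerivAt
  have hGe : HasFDerivAt (fun w : ℂ => gradient u (fsE w))
    (G.comp (fsE.toContinuousLinearEquiv : ℂ →L[ℝ] _)) z := hG'.comp z he
  have hc : ∀ i : Fin 2, HasFDerivAt (fun w : ℂ => ((gradient u (fsE w) i : ℝ) : ℂ))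
      (Complex.ofRealCLM.comp ((EuclideanSpace.proj (𝕜 := ℝ) i).comp
        (G.comp (fsE.toContinuousLinearEquiv : ℂ →L[ℝ] _)))) z := fun i =>
    Complex.ofRealCLM.hasFDerivAt.comp z ((EuclideanSpace.proj (𝕜 := ℝ) i).hasFDerivAt.comp z hGe)
  have hS : HasFDerivAt (fsS u) _ z :=
    (Complex.conjCLE.toContinuousLinearMap.hasFDerivAt (x := z)).sub
      (((hc 0).sub ((hc 1).const_mul Complex.I)).const_mul 2)
  rw [differentiableAt_complex_iff_differentiableAt_real]
  refine ⟨hS.differentiableAt, ?_⟩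
  rw [hS.fderiv]
  have e1 : fsE 1 = EuclideanSpace.single 0 1 := by ext i; fin_cases i <;> simp
  have eI : fsE Complex.I = EuclideanSpace.single 1 1 := by ext i; fin_cases i <;> simp
  simp only [_root_.sub_apply, _root_.smul_apply,
    ContinuousLinearMap.comp_apply, Complex.ofRealCLM_apply, PiLp.proj_apply,
    ContinuousLinearEquiv.coe_coe, LinearIsometryEquiv.coe_toContinuousLinearEquiv, e1, eI,
    Complex.conjCLE_apply, smul_eq_mul, Complex.conj_I, map_one, hs01]
  have h11 : G (EuclideanSpace.single 1 1) 1 = 1 - G (EuclideanSpace.single 0 1) 0 := by linarith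
  rw [h11]
  push_cast
  linear_combination (-2 * ((G (EuclideanSpace.single 1 1)) 0 : ℂ)) * Complex.I_sq

lemma fs_S_lip {u : EuclideanSpace ℝ (Fin 2) → ℝ} {z : ℂ} {R : ℝ} {L : ℝ≥0}
    (hL : LipschitzOnWith L (gradient u) (closedBall (fsE z) R)) :
    LipschitzOnWith (1 + 4 * L) (fsS u) (ball z R) := by
  refine LipschitzOnWith.of_dist_le_mul fun x hx y hy => ?_
  have hm : ∀ x ∈ ball z R, fsE x ∈ closedBall (fsE z) R := fun x hx => by
    rw [mem_closedBall, LinearIsometryEquiv.dist_map]; exact (mem_ball.1 hx).le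
  have h1 := hL.norm_sub_le (hm x hx) (hm y hy)
  rw [← map_sub, LinearIsometryEquiv.norm_map] at h1
  have hi : ∀ i : Fin 2, ‖((gradient u (fsE x) i : ℝ) : ℂ) - ((gradient u (fsE y) i : ℝ) : ℂ)‖
      ≤ L * ‖x - y‖ := fun i => by
    rw [← Complex.ofReal_sub, Complex.norm_real]
    exact (PiLp.norm_apply_le (gradient u (fsE x) - gradient u (fsE y)) i).trans h1
  rw [dist_eq_norm, dist_eq_norm]
  have e : fsS u x - fsS u y = (starRingEnd ℂ) (x - y)
      - 2 * (((gradient u (fsE x) 0 : ℝ) : ℂ) - ((gradient u (fsE y) 0 : ℝ) : ℂ))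
      + 2 * Complex.I * (((gradient u (fsE x) 1 : ℝ) : ℂ) - ((gradient u (fsE y) 1 : ℝ) : ℂ)) := by
    simp only [fsS, map_sub]; ring
  rw [e]
  refine (norm_add_le _ _).trans ?_
  have h2 := norm_sub_le ((starRingEnd ℂ) (x - y))
    (2 * (((gradient u (fsE x) 0 : ℝ) : ℂ) - ((gradient u (fsE y) 0 : ℝ) : ℂ)))
  rw [RCLike.norm_conj] at h2
  have h3 := hi 0
  have h4 := hi 1
  rw [norm_mul] at h2
  rw [norm_mul, norm_mul, Complex.norm_I]
  simp only [Complex.norm_ofNat] at h2 ⊢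
  push_cast
  linarith

lemma fs_S_analytic {Ω : Set (EuclideanSpace ℝ (Fin 2))} (hΩ : IsOpen Ω)
    {u : EuclideanSpace ℝ (Fin 2) → ℝ} (hu : IsObstacleSol Ω u) {z : ℂ} (hz : fsE z ∈ Ω)
    (hp : 0 < u (fsE z)) : AnalyticAt ℂ (fsS u) z := by
  obtain ⟨hd, hLip, hpos, hlap⟩ := hu
  have hnb : ∀ᶠ y in 𝓝 (fsE z), y ∈ Ω ∧ 0 < u y :=
    Filter.inter_mem (hΩ.mem_nhds hz) ((hd _ hz).continuousAt.eventually (lt_mem_nhds hp))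
  obtain ⟨R, hR, hball⟩ := Metric.nhds_basis_closedBall.mem_iff.1 hnb
  obtain ⟨L, hL⟩ := hLip (closedBall (fsE z) R) (fun y hy => (hball hy).1) (isCompact_closedBall _ _)
  refine fs_weyl hR (fs_S_lip hL) ?_
  have h1 : ∀ᵐ x : EuclideanSpace ℝ (Fin 2), x ∈ ball (fsE z) R →
      DifferentiableWithinAt ℝ (gradient u) (ball (fsE z) R) x :=
    (ae_restrict_iff' measurableSet_ball).1
      ((hL.mono ball_subset_closedBall).ae_differentiableWithinAt measurableSet_ball)
  have h2 := (ae_restrict_iff' hΩ.measurableSet).1 hlap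
  have h3 := fsE.measurePreserving.quasiMeasurePreserving.ae (h1.and h2)
  filter_upwards [h3] with w hw hwb
  have hwb' : fsE w ∈ ball (fsE z) R := by
    rw [mem_ball, LinearIsometryEquiv.dist_map]; exact hwb
  have hwc := hball (ball_subset_closedBall hwb')
  refine fs_cr ?_ ((hw.1 hwb').differentiableAt (isOpen_ball.mem_nhds hwb')) ?_
  · filter_upwards [hΩ.mem_nhds hwc.1] with y hy using hd y hy
  · rw [hw.2 hwc.1, if_pos hwc.2]

lemma fs_S_expand {Ω : Set (EuclideanSpace ℝ (Fin 2))} (hΩ : IsOpen Ω)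
    {u : EuclideanSpace ℝ (Fin 2) → ℝ} (hu : IsObstacleSol Ω u) {z : ℂ} (hz : fsE z ∈ Ω)
    (h0 : u (fsE z) = 0) {A : Matrix (Fin 2) (Fin 2) ℝ} (hA : IsBlowup u (fsE z) A) :
    ∀ ε > 0, ∃ ρ > 0, ∀ ζ : ℂ, ‖ζ‖ ≤ ρ →
      ‖fsS u (z + ζ) - (starRingEnd ℂ) z
        - (((A 1 1 - A 0 0 : ℝ) : ℂ) + 2 * (A 0 1 : ℝ) * Complex.I) * ζ‖ ≤ ε * ‖ζ‖ := by
  obtain ⟨hd, hLip, hpos, hlap⟩ := hu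
  have hs : A 1 0 = A 0 1 := by
    have := hA.1.1.isHermitian.apply 0 1
    simpa using this
  have htr : A 0 0 + A 1 1 = 1 := by
    have := hA.1.2
    rwa [Matrix.trace_fin_two] at this
  obtain ⟨δ, hδ, hball⟩ := Metric.nhds_basis_closedBall.mem_iff.1 (hΩ.mem_nhds hz)
  obtain ⟨L, hL⟩ := hLip (closedBall (fsE z) δ) hball (isCompact_closedBall _ _)
  set W := fsW (A 0 0) (A 0 1) (A 1 1) with hW
  have hadd : ∀ h ∈ ball (0 : EuclideanSpace ℝ (Fin 2)) δ, fsE z + h ∈ closedBall (fsE z) δ := by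
    intro h hh
    rw [mem_ball_zero_iff] at hh
    simpa [mem_closedBall, dist_eq_norm] using hh.le
  have key := fs_grad_interp (v := fun h => u (fsE z + h) - quadForm A h)
    (w := fun h => InnerProductSpace.toDual ℝ _ (gradient u (fsE z + h)) - W h)
    (L := L + ‖W‖₊) hδ ?_ ?_ (fs_blow_expand hA h0)
  · intro ε hε
    obtain ⟨ρ, hρ, hk⟩ := key (ε / 4) (by positivity)
    refine ⟨ρ, hρ, fun ζ hζ => ?_⟩
    have h1 := hk (fsE ζ) (by rwa [LinearIsometryEquiv.norm_map])
    rw [LinearIsometryEquiv.norm_map] at h1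
    have hn : ∀ i : Fin 2, ‖EuclideanSpace.single i (1:ℝ)‖ = 1 := fun i => by simp
    have h2 : ∀ i : Fin 2, |gradient u (fsE z + fsE ζ) i - W (fsE ζ) (EuclideanSpace.single i 1)|
        ≤ ε / 4 * ‖ζ‖ := by
      intro i
      have := ContinuousLinearMap.le_of_opNorm_le _ h1 (EuclideanSpace.single i (1:ℝ))
      rw [hn, mul_one] at this
      have hin : InnerProductSpace.toDual ℝ _ (gradient u (fsE z + fsE ζ))
          (EuclideanSpace.single i (1:ℝ)) = gradient u (fsE z + fsE ζ) i := by
        rw [InnerProductSpace.toDual_apply_apply, EuclideanSpace.inner_single_right]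
        simp
      rw [_root_.sub_apply, hin, Real.norm_eq_abs] at this
      exact this
    have a0 := h2 0
    have a1 := h2 1
    simp only [hW, fsW_apply] at a0 a1
    have r0 : fsE ζ 0 = ζ.re := by simp
    have r1 : fsE ζ 1 = ζ.im := by simp
    simp only [r0, r1, PiLp.single_apply] at a0 a1
    norm_num at a0 a1
    set g := gradient u (fsE z + fsE ζ) with hg
    have e : fsS u (z + ζ) - (starRingEnd ℂ) z
        - (((A 1 1 - A 0 0 : ℝ) : ℂ) + 2 * (A 0 1 : ℝ) * Complex.I) * ζ
        = -2 * ((g 0 - (ζ.re * A 0 0 + ζ.im * A 0 1) : ℝ) : ℂ)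
          + 2 * Complex.I * ((g 1 - (ζ.re * A 0 1 + ζ.im * A 1 1) : ℝ) : ℂ) := by
      have h11 : A 1 1 = 1 - A 0 0 := by linarith
      simp only [fsS, map_add, ← hg, h11]
      apply Complex.ext <;> simp <;> ring
    rw [e]
    refine (norm_add_le _ _).trans ?_
    rw [norm_mul, norm_mul, norm_mul, Complex.norm_I, Complex.norm_real, Complex.norm_real,
      Real.norm_eq_abs, Real.norm_eq_abs, norm_neg, Complex.norm_ofNat]
    linarith
  · intro h hh
    have hx := hball (hadd h hh)
    have e1 := (hd _ hx).hasGradientAt.hasFDerivAt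
    have e2 : HasFDerivAt (fun h => u (fsE z + h))
        (InnerProductSpace.toDual ℝ _ (gradient u (fsE z + h))) h := by
      have e3 : HasFDerivAt (fun h : EuclideanSpace ℝ (Fin 2) => fsE z + h)
        (ContinuousLinearMap.id ℝ _) h := (hasFDerivAt_id h).const_add _
      exact e1.comp h e3
    exact e2.sub (fs_quad_deriv hs h)
  · refine LipschitzOnWith.sub ?_ (W.lipschitz.lipschitzOnWith)
    refine LipschitzOnWith.of_dist_le_mul fun x hx y hy => ?_
    rw [LinearIsometryEquiv.dist_map]
    simpa using hL.dist_le_mul _ (hadd x hx) _ (hadd y hy)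

lemma fs_sing_zero {Ω : Set (EuclideanSpace ℝ (Fin 2))}
    {u : EuclideanSpace ℝ (Fin 2) → ℝ} (hu : IsObstacleSol Ω u) (hΩ : IsOpen Ω)
    {y : EuclideanSpace ℝ (Fin 2)}
    (hy : IsSingularPt Ω u y) : y ∈ Ω ∧ u y = 0 := by
  have hyΩ := hy.1.2
  refine ⟨hyΩ, ?_⟩
  by_contra hne
  have hp : 0 < u y := lt_of_le_of_ne (hu.2.2.1 y hyΩ) (Ne.symm hne)
  have hn : {x | x ∈ Ω ∧ 0 < u x} ∈ 𝓝 y :=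
    Filter.inter_mem (hΩ.mem_nhds hyΩ) ((hu.1 y hyΩ).continuousAt.eventually (lt_mem_nhds hp))
  exact hy.1.1.2 (mem_interior_iff_mem_nhds.2 hn)

lemma fs_kappa {A : Matrix (Fin 2) (Fin 2) ℝ} (hA : MemP A)
    (hk : Module.finrank ℝ (LinearMap.ker (Matrix.toLin' A)) = 1) :
    ‖((A 1 1 - A 0 0 : ℝ) : ℂ) + 2 * (A 0 1 : ℝ) * Complex.I‖ = 1 := by
  have hs : A 1 0 = A 0 1 := by
    have := hA.1.isHermitian.apply 0 1
    simpa using this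
  have htr : A 0 0 + A 1 1 = 1 := by
    have := hA.2
    rwa [Matrix.trace_fin_two] at this
  have hdet : A.det = 0 := by
    rw [← Matrix.exists_mulVec_eq_zero_iff]
    have hne : LinearMap.ker (Matrix.toLin' A) ≠ ⊥ := by
      intro h
      rw [h, finrank_bot] at hk
      exact absurd hk (by norm_num)
    obtain ⟨v, hv, hv0⟩ := Submodule.exists_mem_ne_zero_of_ne_bot hne
    refine ⟨v, hv0, ?_⟩
    simpa using hv
  rw [Matrix.det_fin_two, hs] at hdet
  have h1 : Complex.normSq (((A 1 1 - A 0 0 : ℝ) : ℂ) + 2 * (A 0 1 : ℝ) * Complex.I) = 1 := by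
    rw [Complex.normSq_apply]
    simp
    nlinarith
  rw [Complex.norm_def, h1, Real.sqrt_one]

theorem fs_main
    (Ω : Set (EuclideanSpace ℝ (Fin 2))) (hΩopen : IsOpen Ω)
    (u : EuclideanSpace ℝ (Fin 2) → ℝ) (hu : IsObstacleSol Ω u)
    (x0 : EuclideanSpace ℝ (Fin 2)) (hx0 : IsSingularPt Ω u x0)
    (hx0' : ∃ A : Matrix (Fin 2) (Fin 2) ℝ, IsBlowup u x0 A ∧
      Module.finrank ℝ (LinearMap.ker (Matrix.toLin' A)) = 1) :
    ∃ U : Set (EuclideanSpace ℝ (Fin 2)), IsOpen U ∧ x0 ∈ U ∧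
      ∃ Γ : Set (EuclideanSpace ℝ (Fin 2)), IsC2Curve Γ ∧
        {y | IsSingularPt Ω u y ∧
          ∃ A : Matrix (Fin 2) (Fin 2) ℝ, IsBlowup u y A ∧
            Module.finrank ℝ (LinearMap.ker (Matrix.toLin' A)) = 1} ∩ U ⊆ Γ := by
  obtain ⟨A, hA, hAk⟩ := hx0'
  obtain ⟨hxΩ, hux⟩ := fs_sing_zero hu hΩopen hx0
  set z0 : ℂ := fsE.symm x0 with hz0
  have ez0 : fsE z0 = x0 := fsE.apply_symm_apply x0
  set κ : ℂ := ((A 1 1 - A 0 0 : ℝ) : ℂ) + 2 * (A 0 1 : ℝ) * Complex.I with hκ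
  have hκ1 : ‖κ‖ = 1 := fs_kappa hA.1 hAk
  have hκ0 : κ ≠ 0 := by rw [← norm_ne_zero_iff, hκ1]; norm_num
  obtain ⟨μ, hμ⟩ := IsAlgClosed.exists_pow_nat_eq κ⁻¹ (n := 2) (by norm_num)
  have hμκ : μ ^ 2 * κ = 1 := by rw [hμ, inv_mul_cancel₀ hκ0]
  have hμ1 : ‖μ‖ = 1 := by
    have : ‖μ‖ ^ 2 = 1 := by rw [← norm_pow, hμ, norm_inv, hκ1, inv_one]
    nlinarith [norm_nonneg μ]
  have hμc : μ * (starRingEnd ℂ) μ = 1 := by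
    rw [Complex.mul_conj, Complex.normSq_eq_norm_sq, hμ1]; norm_num
  have hμc2 : (starRingEnd ℂ) μ * μ = 1 := by rw [mul_comm, hμc]
  obtain ⟨R, hR, hball⟩ := Metric.nhds_basis_closedBall.mem_iff.1 (hΩopen.mem_nhds hxΩ)
  obtain ⟨L, hL⟩ := hu.2.1 (closedBall x0 R) hball (isCompact_closedBall _ _)
  rw [← ez0] at hL
  have hSc := (fs_S_lip hL).continuousOn
  -- the normalised function
  set T : ℂ → ℂ := fun ζ => μ * (fsS u (z0 + μ * ζ) - (starRingEnd ℂ) z0) with hT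
  have hmaps : ∀ ζ ∈ ball (0:ℂ) R, z0 + μ * ζ ∈ ball z0 R := by
    intro ζ hζ
    rw [mem_ball_zero_iff] at hζ
    rw [mem_ball, dist_eq_norm, add_sub_cancel_left, norm_mul, hμ1, one_mul]
    exact hζ
  have hmapΩ : ∀ ζ ∈ ball (0:ℂ) R, fsE (z0 + μ * ζ) ∈ Ω := by
    intro ζ hζ
    apply hball
    rw [← ez0, mem_closedBall, LinearIsometryEquiv.dist_map]
    exact (mem_ball.1 (hmaps ζ hζ)).le
  have hexp : ∀ ζ : ℂ, ∀ B : Matrix (Fin 2) (Fin 2) ℝ, fsE (z0 + μ * ζ) ∈ Ω →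
      u (fsE (z0 + μ * ζ)) = 0 → IsBlowup u (fsE (z0 + μ * ζ)) B →
      ∀ ε > 0, ∃ ρ > 0, ∀ η : ℂ, ‖η‖ ≤ ρ →
        ‖T (ζ + η) - (starRingEnd ℂ) ζ - (μ ^ 2 * (((B 1 1 - B 0 0 : ℝ) : ℂ)
          + 2 * (B 0 1 : ℝ) * Complex.I)) * η‖ ≤ ε * ‖η‖ := by
    intro ζ B h1 h2 h3 ε hε
    obtain ⟨ρ, hρ, h⟩ := fs_S_expand hΩopen hu h1 h2 h3 ε hε
    refine ⟨ρ, hρ, fun η hη => ?_⟩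
    have hn : ‖μ * η‖ = ‖η‖ := by rw [norm_mul, hμ1, one_mul]
    have h4 := h (μ * η) (by rw [hn]; exact hη)
    rw [hn] at h4
    refine le_trans (le_of_eq ?_) h4
    rw [← one_mul ‖fsS u _ - _ - _‖, ← hμ1, ← norm_mul]
    congr 1
    simp only [hT, map_add, map_mul]
    have e : z0 + μ * (ζ + η) = z0 + μ * ζ + μ * η := by ring
    rw [e]
    linear_combination (-(starRingEnd ℂ) ζ) * hμc + 2 * (starRingEnd ℂ) ζ * hμc
  have hc1 : ContinuousOn T (ball 0 R) := by
    refine ContinuousOn.mul continuousOn_const (ContinuousOn.sub ?_ continuousOn_const)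
    exact hSc.comp (by fun_prop) hmaps
  have hc2 : ∀ ζ ∈ {ζ | ζ ∈ ball (0:ℂ) R ∧ u (fsE (z0 + μ * ζ)) = 0},
      T ζ = (starRingEnd ℂ) ζ := by
    rintro ζ ⟨hζ, h0⟩
    have hg := fs_grad_zero hΩopen hu.2.2.1 (hmapΩ ζ hζ) h0
    have hS : fsS u (z0 + μ * ζ) = (starRingEnd ℂ) (z0 + μ * ζ) := by
      rw [fsS, hg]; simp
    simp only [hT, hS, map_add, map_mul]
    linear_combination (starRingEnd ℂ) ζ * hμc
  have hc3 : ∀ ζ ∈ ball (0:ℂ) R, ζ ∉ {ζ | ζ ∈ ball (0:ℂ) R ∧ u (fsE (z0 + μ * ζ)) = 0} →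
      AnalyticAt ℂ T ζ := by
    intro ζ hζ hn
    have hp : 0 < u (fsE (z0 + μ * ζ)) := by
      refine lt_of_le_of_ne (hu.2.2.1 _ (hmapΩ ζ hζ)) fun h => hn ?_
      exact ⟨hζ, h.symm⟩
    have h1 := fs_S_analytic hΩopen hu (hmapΩ ζ hζ) hp
    have h2 : AnalyticAt ℂ (fun ζ : ℂ => z0 + μ * ζ) ζ := by fun_prop
    have h3 : AnalyticAt ℂ (fun ζ : ℂ => fsS u (z0 + μ * ζ)) ζ :=
      AnalyticAt.fun_comp (g := fsS u) (f := fun ζ : ℂ => z0 + μ * ζ) h1 h2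
    exact analyticAt_const.mul (h3.sub analyticAt_const)
  have hc4 : ∀ ε > 0, ∃ r > 0, ∀ z : ℂ, ‖z‖ ≤ r → ‖T z - z‖ ≤ ε * ‖z‖ := by
    intro ε hε
    have e0 : fsE (z0 + μ * 0) = x0 := by rw [mul_zero, add_zero, ez0]
    obtain ⟨ρ, hρ, h⟩ := hexp 0 A (by rw [e0]; exact hxΩ) (by rw [e0]; exact hux)
      (by rw [e0]; exact hA) ε hε
    refine ⟨ρ, hρ, fun z hz => ?_⟩
    have := h z hz
    rw [← hκ, hμκ] at this
    simpa using this
  obtain ⟨s, hs, F, hF, hFs⟩ := fs_complex hR hc1 hc2 hc3 hc4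
  -- the affine coordinate
  set Z : EuclideanSpace ℝ (Fin 2) → ℂ := fun p => (starRingEnd ℂ) μ * (fsE.symm p - z0) with hZ
  have hZc : ContDiff ℝ 2 Z := by
    have : ContDiff ℝ 2 (fun p => fsE.symm p) := fsE.symm.contDiff
    exact contDiff_const.mul (this.sub contDiff_const)
  have hZinv : ∀ p, fsE (z0 + μ * Z p) = p := by
    intro p
    have : z0 + μ * Z p = fsE.symm p := by
      simp only [hZ]
      linear_combination (fsE.symm p - z0) * hμc
    rw [this, LinearIsometryEquiv.apply_symm_apply]
  set U : Set (EuclideanSpace ℝ (Fin 2)) := Z ⁻¹' (ball 0 s) with hU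
  have hUo : IsOpen U := isOpen_ball.preimage hZc.continuous
  set G : EuclideanSpace ℝ (Fin 2) → ℝ := fun p => (Z p).im - (F ((Z p).re : ℂ)).im / 2 with hG
  have hGc : ContDiffOn ℝ 2 G U := by
    have hF2 : ContDiffOn ℝ 2 F (ball 0 s) :=
      (hF.contDiffOn isOpen_ball (n := 2)).restrict_scalars ℝ
    have h1 : ContDiff ℝ 2 (fun p => (((Z p).re : ℝ) : ℂ)) :=
      Complex.ofRealCLM.contDiff.comp (Complex.reCLM.contDiff.comp hZc)
    have h2 : ContDiffOn ℝ 2 (fun p => F ((Z p).re : ℂ)) U := by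
      refine hF2.comp h1.contDiffOn fun p hp => ?_
      have hp' : ‖Z p‖ < s := by simpa [hU] using hp
      rw [mem_ball_zero_iff, Complex.norm_real]
      exact (Complex.abs_re_le_norm _).trans_lt hp'
    have h3 : ContDiffOn ℝ 2 (fun p => (F ((Z p).re : ℂ)).im) U :=
      Complex.imCLM.contDiff.comp_contDiffOn h2
    have h4 : ContDiff ℝ 2 (fun p => (Z p).im) := Complex.imCLM.contDiff.comp hZc
    exact h4.contDiffOn.sub (h3.div_const 2)
  refine ⟨U, hUo, ?_, {p | p ∈ U ∧ G p = 0}, ?_, ?_⟩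
  · simp [hU, hZ, hz0, hs]
  · intro y hy
    refine ⟨U, hUo, hy.1, G, hGc, ?_, ?_⟩
    · ext p
      constructor
      · rintro ⟨h1, _⟩; exact h1
      · intro h1; exact ⟨h1, h1.1⟩
    · rintro p ⟨_, hp⟩ h0
      have hd : DifferentiableAt ℝ G p :=
        (hGc.contDiffAt (hUo.mem_nhds hp)).differentiableAt (by norm_num)
      have h1 : HasFDerivAt G (0 : EuclideanSpace ℝ (Fin 2) →L[ℝ] ℝ) p := h0 ▸ hd.hasFDerivAt
      set d := fsE (μ * Complex.I) with hd'
      have hline : HasDerivAt (fun t : ℝ => p + t • d) d 0 := by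
        simpa using ((hasDerivAt_id (0:ℝ)).smul_const d).const_add p
      have h1' : HasFDerivAt G (0 : EuclideanSpace ℝ (Fin 2) →L[ℝ] ℝ) (p + (0:ℝ) • d) := by
        simpa using h1
      have h2 : HasDerivAt (fun t : ℝ => G (p + t • d)) 0 0 := by
        have := h1'.comp_hasDerivAt (0:ℝ) hline
        exact this
      have hZl : ∀ t : ℝ, Z (p + t • d) = Z p + t * Complex.I := by
        intro t
        simp only [hZ, hd', map_add, map_smul, LinearIsometryEquiv.symm_apply_apply,
          Complex.real_smul]
        linear_combination (t * Complex.I) * hμc2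
      have h3 : (fun t : ℝ => G (p + t • d)) = fun t : ℝ => t + G p := by
        funext t
        simp only [hG, hZl]
        simp
        ring
      rw [h3] at h2
      have h4 : HasDerivAt (fun t : ℝ => t + G p) 1 0 := (hasDerivAt_id (0:ℝ)).add_const _
      exact zero_ne_one (h2.unique h4)
  · rintro y ⟨⟨hy, B, hB, -⟩, hyU⟩
    obtain ⟨hyΩ, huy⟩ := fs_sing_zero hu hΩopen hy
    refine ⟨hyU, ?_⟩
    have e := hZinv y
    have := hFs (Z y) hyU _ (hexp (Z y) B (by rw [e]; exact hyΩ) (by rw [e]; exact huy)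
      (by rw [e]; exact hB))
    simp only [hG, this, sub_self]

/-- Figalli–Serra, n = 2: for a solution of the normalized
obstacle problem in the plane, the singular stratum `Σ_1` is locally contained
in a curve of class `C²`. -/
theorem figalli_serra_two_dimensional_C2
    (Ω : Set (EuclideanSpace ℝ (Fin 2))) (hΩopen : IsOpen Ω)
    (u : EuclideanSpace ℝ (Fin 2) → ℝ) (hu : IsObstacleSol Ω u)
    (x0 : EuclideanSpace ℝ (Fin 2)) (hx0 : IsSingularPt Ω u x0)
    (hx0' : ∃ A : Matrix (Fin 2) (Fin 2) ℝ, IsBlowup u x0 A ∧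
      Module.finrank ℝ (LinearMap.ker (Matrix.toLin' A)) = 1) :
    ∃ U : Set (EuclideanSpace ℝ (Fin 2)), IsOpen U ∧ x0 ∈ U ∧
      ∃ Γ : Set (EuclideanSpace ℝ (Fin 2)), IsC2Curve Γ ∧
        {y | IsSingularPt Ω u y ∧
          ∃ A : Matrix (Fin 2) (Fin 2) ℝ, IsBlowup u y A ∧
            Module.finrank ℝ (LinearMap.ker (Matrix.toLin' A)) = 1} ∩ U ⊆ Γ := by
  exact fs_main Ω hΩopen u hu x0 hx0 hx0'
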